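/- arXiv:2406.14342 — 4 statements merged into one kernel-verified Lean document; each statement's English description precedes it below -/
import Mathlib

section
/- Let s ≥ 0, 2/5 ≤ b < 1/2, and 0 ≤ a ≤ 10b - 4. Then there exists C > 0 (depending only on s, a, b) such that for all Schwartz functions v, w : ℝ² → ℂ, ‖∂_x(vw)‖_{X^{s+a,-b}} ≤ C ‖v‖_{X^{s,b}} ‖w‖_{X^{s,b}}, where ∂_x(vw) denotes the partial derivative with respect to the first variable of the pointwise product vw. -/
open MeasureTheory
open scoped Real

/-- Fourier transform on ℝ²: `f̂(ξ,τ) = (2π)^{-1} ∬ e^{-i(xξ+tτ)} f(x,t) dx dt`. -/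
noncomputable def FT2 (f : ℝ → ℝ → ℂ) (ξ τ : ℝ) : ℂ :=
  ((2 * π : ℝ) : ℂ)⁻¹ * ∫ x : ℝ, ∫ t : ℝ, Complex.exp (-Complex.I * (x * ξ + t * τ)) * f x t

/-- Bourgain `X^{s,b}` norm associated to `∂_t + ∂_x⁵`. -/
noncomputable def Xnorm (s b : ℝ) (f : ℝ → ℝ → ℂ) : ℝ :=
  Real.sqrt (∫ ξ : ℝ, ∫ τ : ℝ,
    (1 + |ξ|) ^ (2 * s) * (1 + |τ + ξ ^ 5|) ^ (2 * b) * ‖FT2 f ξ τ‖ ^ 2)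

/-- Partial derivative with respect to the first variable of the pointwise product `v·w`. -/
noncomputable def dxProd (v w : ℝ × ℝ → ℂ) : ℝ → ℝ → ℂ :=
  fun x t => deriv (fun y : ℝ => v (y, t) * w (y, t)) x

section FourierPart
open FourierTransform SchwartzMap LineDeriv Convolution
open scoped SchwartzMap

abbrev EE := WithLp 2 (ℝ × ℝ)

noncomputable def LL : EE ≃L[ℝ] ℝ × ℝ := WithLp.prodContinuousLinearEquiv 2 ℝ ℝ ℝ

noncomputable def liftE (v : 𝓢(ℝ × ℝ, ℂ)) : 𝓢(EE, ℂ) :=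
  SchwartzMap.compCLMOfContinuousLinearEquiv ℝ LL v

lemma liftE_apply (v : 𝓢(ℝ × ℝ, ℂ)) (p : ℝ × ℝ) : liftE v (WithLp.toLp 2 p) = v p := rfl

noncomputable def dil : (ℝ × ℝ) ≃L[ℝ] EE :=
  LL.symm.trans (ContinuousLinearEquiv.smulLeft (Units.mk0 ((2 * π)⁻¹ : ℝ) (by positivity)))

lemma dil_apply (p : ℝ × ℝ) : dil p = (2 * π)⁻¹ • (WithLp.toLp 2 p : EE) := rfl

noncomputable def FS (v : 𝓢(ℝ × ℝ, ℂ)) : 𝓢(ℝ × ℝ, ℂ) :=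
  ((2 * π : ℝ) : ℂ)⁻¹ • SchwartzMap.compCLMOfContinuousLinearEquiv ℝ dil (𝓕 (liftE v))

lemma FS_apply (v : 𝓢(ℝ × ℝ, ℂ)) (p : ℝ × ℝ) :
    FS v p = ((2 * π : ℝ) : ℂ)⁻¹ * 𝓕 (liftE v) (dil p) := rfl

lemma FT2_lift (U : 𝓢(EE, ℂ)) (ξ τ : ℝ) :
    FT2 (fun x t => U (WithLp.toLp 2 (x, t))) ξ τ =
      ((2 * π : ℝ) : ℂ)⁻¹ * 𝓕 U (dil (ξ, τ)) := by
  unfold FT2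
  congr 1
  rw [SchwartzMap.fourier_coe, Real.fourier_eq]
  have hmp := WithLp.volume_preserving_toLp ℝ ℝ
  rw [← hmp.integral_comp (MeasurableEquiv.toLp 2 (ℝ × ℝ)).measurableEmbedding]
  have hintg : Integrable (fun p : ℝ × ℝ => Real.fourierChar (-(inner ℝ (WithLp.toLp 2 p : EE) (dil (ξ, τ)))) •
      U (WithLp.toLp 2 p)) volume := by
    have h1 : Integrable (fun z : EE => Real.fourierChar (-(inner ℝ z (dil (ξ, τ)))) • U z) volume := by
      exact (Real.fourierIntegral_convergent_iff (dil (ξ, τ))).2 U.integrable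
    exact hmp.integrable_comp_of_integrable h1
  rw [Measure.volume_eq_prod] at hintg ⊢
  rw [integral_prod _ hintg]
  refine integral_congr_ae (Filter.Eventually.of_forall fun x => ?_)
  refine integral_congr_ae (Filter.Eventually.of_forall fun t => ?_)
  simp only [Circle.smul_def, Real.fourierChar_apply, smul_eq_mul, dil_apply]
  congr 2
  simp [inner_smul_right, WithLp.prod_inner_apply]
  field_simp

lemma FT2_eq (v : 𝓢(ℝ × ℝ, ℂ)) (ξ τ : ℝ) :
    FT2 (fun x t => v (x, t)) ξ τ = FS v (ξ, τ) := by
  rw [FS_apply, ← FT2_lift]; rfl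

noncomputable def prodE (v w : 𝓢(ℝ × ℝ, ℂ)) : 𝓢(EE, ℂ) :=
  pairing (ContinuousLinearMap.mul ℂ ℂ) (liftE v) (liftE w)

lemma prodE_apply (v w : 𝓢(ℝ × ℝ, ℂ)) (z : EE) : prodE v w z = liftE v z * liftE w z := rfl

lemma dxProd_eq (v w : 𝓢(ℝ × ℝ, ℂ)) :
    dxProd (⇑v) (⇑w) = fun x t => (∂_{(WithLp.toLp 2 ((1 : ℝ), (0 : ℝ)) : EE)} (prodE v w)) (WithLp.toLp 2 (x, t)) := by
  funext x t
  rw [SchwartzMap.lineDerivOp_apply_eq_fderiv]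
  unfold dxProd
  have h : (fun y : ℝ => v (y, t) * w (y, t)) =
      (prodE v w) ∘ (fun y : ℝ => (WithLp.toLp 2 (y, t) : EE)) := rfl
  rw [h]
  have h1 : HasDerivAt (fun y : ℝ => (WithLp.toLp 2 (y, t) : EE)) (WithLp.toLp 2 ((1 : ℝ), (0 : ℝ))) x := by
    have h2 : HasDerivAt (fun y : ℝ => (y, t)) ((1 : ℝ), (0 : ℝ)) x :=
      (hasDerivAt_id x).prodMk (hasDerivAt_const x t)
    exact (LL.symm.hasFDerivAt (x := (x, t))).comp_hasDerivAt x h2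
  exact ((prodE v w).differentiableAt.hasFDerivAt.comp_hasDerivAt x h1).deriv

lemma norm_fourier_prodE (v w : 𝓢(ℝ × ℝ, ℂ)) (z : EE) :
    ‖𝓕 (prodE v w) z‖ₑ ≤ ∫⁻ y : EE, ‖𝓕 (liftE v) y‖ₑ * ‖𝓕 (liftE w) (z - y)‖ₑ := by
  have hneg : ∀ (f : 𝓢(EE, ℂ)) (y : EE), 𝓕⁻ f y = 𝓕 f (-y) := by
    intro f y
    rw [SchwartzMap.fourier_coe, SchwartzMap.fourierInv_coe, Real.fourierInv_eq_fourier_neg]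
  have h1 : SchwartzMap.convolution (ContinuousLinearMap.mul ℂ ℂ) (𝓕⁻ (liftE v)) (𝓕⁻ (liftE w)) = 𝓕⁻ (prodE v w) := by
    have := fourier_convolution (ContinuousLinearMap.mul ℂ ℂ) (𝓕⁻ (liftE v)) (𝓕⁻ (liftE w))
    simp only [FourierTransform.fourier_fourierInv_eq] at this
    unfold prodE
    rw [← this, FourierTransform.fourierInv_fourier_eq]
  have h2 : 𝓕 (prodE v w) z = 𝓕⁻ (prodE v w) (-z) := by rw [hneg, neg_neg]
  rw [h2, ← h1, convolution_apply, MeasureTheory.convolution]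
  refine (enorm_integral_le_lintegral_enorm _).trans ?_
  rw [← lintegral_neg_eq_self]
  refine lintegral_mono fun y => ?_
  simp only [ContinuousLinearMap.mul_apply', hneg, enorm_mul]
  rw [neg_neg]
  apply le_of_eq
  congr 3
  abel

lemma FT2_dxProd_le : ∃ C : ENNReal, C ≠ ⊤ ∧ ∀ (v w : 𝓢(ℝ × ℝ, ℂ)) (ξ τ : ℝ),
    ‖FT2 (dxProd (⇑v) (⇑w)) ξ τ‖ₑ ≤
      C * ‖ξ‖ₑ * ∫⁻ q : ℝ × ℝ, ‖FS v q‖ₑ * ‖FS w ((ξ, τ) - q)‖ₑ := by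
  have hH : (Measure.map dil (volume : Measure (ℝ × ℝ))).IsAddHaarMeasure :=
    dil.isAddHaarMeasure_map _
  obtain ⟨c, hc0, hct, hc⟩ : ∃ c : ENNReal, c ≠ 0 ∧ c ≠ ⊤ ∧
      (volume : Measure EE) = c • Measure.map dil (volume : Measure (ℝ × ℝ)) := by
    refine ⟨Measure.addHaarScalarFactor volume (Measure.map dil (volume : Measure (ℝ × ℝ))), ?_, by simp,
      Measure.isAddLeftInvariant_eq_smul _ _⟩
    exact_mod_cast (Measure.addHaarScalarFactor_pos_of_isAddHaarMeasure _ _).ne'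
  set k : ℂ := ((2 * π : ℝ) : ℂ)⁻¹ with hk
  have hk0 : k ≠ 0 := by
    rw [hk]; simp [Real.pi_ne_zero]
  have hFS : ∀ (v : 𝓢(ℝ × ℝ, ℂ)) q, ‖𝓕 (liftE v) (dil q)‖ₑ = ‖k⁻¹‖ₑ * ‖FS v q‖ₑ := by
    intro v q
    rw [FS_apply, ← enorm_mul, ← hk, inv_mul_cancel_left₀ hk0]
  refine ⟨c * ‖k⁻¹‖ₑ * ‖k⁻¹‖ₑ * ‖k‖ₑ, by finiteness, fun v w ξ τ => ?_⟩
  rw [dxProd_eq, FT2_lift, SchwartzMap.fourier_lineDerivOp_eq]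
  have h1 : ((2 * (π : ℂ) * Complex.I) • smulLeftCLM ℂ (inner ℝ · (WithLp.toLp 2 ((1 : ℝ), (0 : ℝ)) : EE))
      (𝓕 (prodE v w))) (dil (ξ, τ)) = (ξ : ℂ) * (Complex.I * 𝓕 (prodE v w) (dil (ξ, τ))) := by
    have : (inner ℝ · (WithLp.toLp 2 ((1 : ℝ), (0 : ℝ)) : EE)).HasTemperateGrowth := by fun_prop
    rw [_root_.smul_apply, smulLeftCLM_apply_apply this]
    simp [dil_apply, inner_smul_left, WithLp.prod_inner_apply]
    field_simp
  rw [h1]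
  simp only [enorm_mul]
  have h2 : ‖(Complex.I)‖ₑ = 1 := by simp [enorm_eq_nnnorm]
  have h3 : ‖(ξ : ℂ)‖ₑ = ‖ξ‖ₑ := by simp [enorm_eq_nnnorm]
  rw [h2, h3, one_mul]
  have h4 := norm_fourier_prodE v w (dil (ξ, τ))
  have h5 : ∫⁻ y : EE, ‖𝓕 (liftE v) y‖ₑ * ‖𝓕 (liftE w) (dil (ξ, τ) - y)‖ₑ =
      c * ‖k⁻¹‖ₑ * ‖k⁻¹‖ₑ * ∫⁻ q : ℝ × ℝ, ‖FS v q‖ₑ * ‖FS w ((ξ, τ) - q)‖ₑ := by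
    rw [hc, lintegral_smul_measure, lintegral_map]
    · simp_rw [← map_sub, hFS]
      have hm : Measurable (fun q : ℝ × ℝ => ‖FS v q‖ₑ * ‖FS w ((ξ, τ) - q)‖ₑ) := by
        have h6 := (FS v).continuous.measurable
        have h7 := (FS w).continuous.measurable
        have h8 : Measurable fun q : ℝ × ℝ => FS w ((ξ, τ) - q) := h7.comp (by fun_prop)
        exact h6.enorm.mul h8.enorm
      rw [smul_eq_mul, mul_assoc, mul_assoc, ← lintegral_const_mul _ hm,
        ← lintegral_const_mul _ (hm.const_mul _)]
      congr 1
      refine lintegral_congr fun q => ?_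
      ring
    · have h6 := (𝓕 (liftE v)).continuous
      have h7 := (𝓕 (liftE w)).continuous
      fun_prop
    · exact dil.continuous.measurable
  rw [h5] at h4
  calc _ ≤ ‖k‖ₑ * (‖ξ‖ₑ * (c * ‖k⁻¹‖ₑ * ‖k⁻¹‖ₑ * ∫⁻ q : ℝ × ℝ, ‖FS v q‖ₑ * ‖FS w ((ξ, τ) - q)‖ₑ)) := by gcongr
    _ = _ := by ring

end FourierPart

section KernelPart

lemma phase_lower (ξ σ : ℝ) (hξ : ξ ≠ 0) : ∃ d : ℝ, 0 ≤ d ∧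
    (∀ y : ℝ, 5 * |ξ| * (|(|y| - d)| * (|y| + d) * (y ^ 2 + ξ ^ 2 / 4 + d ^ 2)) ≤
      |σ - ξ ^ 5 + ξ ^ 5 / 16 + 5 / 2 * ξ ^ 3 * y ^ 2 + 5 * ξ * y ^ 4|) ∧
    (d < |ξ| / 8 → |ξ| ^ 5 / 2 ≤ |σ|) := by
  set A : ℝ := ξ ^ 4 / 4 - σ / (5 * ξ) with hA
  have hE : ∀ y : ℝ, σ - ξ ^ 5 + ξ ^ 5 / 16 + 5 / 2 * ξ ^ 3 * y ^ 2 + 5 * ξ * y ^ 4 =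
      5 * ξ * ((y ^ 2 + ξ ^ 2 / 4) ^ 2 - A) := by
    intro y; rw [hA]; field_simp; ring
  have hσ : |σ| = 5 * |ξ| * |ξ ^ 4 / 4 - A| := by
    have : σ = 5 * ξ * (ξ ^ 4 / 4 - A) := by rw [hA]; field_simp; ring
    conv_lhs => rw [this]
    rw [abs_mul, abs_mul, abs_of_pos (by norm_num : (0 : ℝ) < 5)]
  have hEa : ∀ y : ℝ, |σ - ξ ^ 5 + ξ ^ 5 / 16 + 5 / 2 * ξ ^ 3 * y ^ 2 + 5 * ξ * y ^ 4| =
      5 * |ξ| * |(y ^ 2 + ξ ^ 2 / 4) ^ 2 - A| := by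
    intro y
    rw [hE, abs_mul, abs_mul, abs_of_pos (by norm_num : (0 : ℝ) < 5)]
  have hx0 : 0 < |ξ| := abs_pos.2 hξ
  have hx2 : |ξ| ^ 2 = ξ ^ 2 := sq_abs ξ
  have hx4 : |ξ| ^ 4 = ξ ^ 4 := by
    rw [show |ξ| ^ 4 = (|ξ| ^ 2) ^ 2 by ring, hx2]; ring
  have key : ∀ d : ℝ, 0 ≤ d → A ≤ (ξ ^ 2 / 4 + d ^ 2) ^ 2 → d < |ξ| / 8 → |ξ| ^ 5 / 2 ≤ |σ| := by
    intro d hd hAd hdl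
    rw [hσ]
    have h1 : d ^ 2 ≤ ξ ^ 2 / 64 := by
      rw [← hx2]; nlinarith
    have h2 : A ≤ (17 / 64) ^ 2 * ξ ^ 4 := by
      refine hAd.trans ?_
      have : (ξ ^ 2 / 4 + d ^ 2) ^ 2 ≤ (17 / 64 * ξ ^ 2) ^ 2 :=
        pow_le_pow_left₀ (by positivity) (by linarith) 2
      refine this.trans (le_of_eq (by ring))
    have h3 : |ξ| ^ 4 / 10 ≤ |ξ ^ 4 / 4 - A| := by
      refine le_trans ?_ (le_abs_self _)
      rw [hx4]
      have : 0 ≤ ξ ^ 4 := by positivity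
      linarith
    calc |ξ| ^ 5 / 2 = 5 * |ξ| * (|ξ| ^ 4 / 10) := by ring
      _ ≤ _ := by gcongr
  by_cases hc : A ≤ (ξ ^ 2 / 4) ^ 2
  · refine ⟨0, le_rfl, fun y => ?_, key 0 le_rfl (by simpa using hc)⟩
    rw [hEa]
    gcongr
    refine le_trans ?_ (le_abs_self _)
    rw [sub_zero, abs_abs, add_zero, ← sq, sq_abs]
    nlinarith [sq_nonneg y, sq_nonneg ξ, mul_nonneg (sq_nonneg y) (sq_nonneg ξ)]
  · push Not at hc
    have hA0 : 0 ≤ A := le_trans (by positivity) hc.le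
    have hB : ξ ^ 2 / 4 < √A := Real.lt_sqrt_of_sq_lt hc
    set d := √(√A - ξ ^ 2 / 4) with hd
    have hd2 : d ^ 2 = √A - ξ ^ 2 / 4 := Real.sq_sqrt (by linarith)
    have hAB : A = (ξ ^ 2 / 4 + d ^ 2) ^ 2 := by
      rw [hd2]; ring_nf; rw [Real.sq_sqrt hA0]
    refine ⟨d, Real.sqrt_nonneg _, fun y => ?_, key d (Real.sqrt_nonneg _) hAB.le⟩
    rw [hEa]
    gcongr
    have h0 : 0 ≤ d := Real.sqrt_nonneg _
    have h1 : (y ^ 2 + ξ ^ 2 / 4) ^ 2 - A =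
      (|y| - d) * (|y| + d) * (y ^ 2 + ξ ^ 2 / 2 + d ^ 2) := by
      rw [hAB]
      rw [show (|y| - d) * (|y| + d) = |y| ^ 2 - d ^ 2 by ring, sq_abs]; ring
    rw [h1, abs_mul, abs_mul, abs_of_nonneg (by positivity : 0 ≤ |y| + d),
      abs_of_nonneg (by positivity : 0 ≤ y ^ 2 + ξ ^ 2 / 2 + d ^ 2)]
    gcongr
    norm_num

lemma phase_lower2 (N d y x : ℝ) (hN : 0 ≤ N) (hd : 0 ≤ d) (hx : 0 ≤ x) :
    5 / 2 * N * |(|y| - d)| ^ 4 ≤ 5 * N * (|(|y| - d)| * (|y| + d) * (y ^ 2 + x + d ^ 2)) ∧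
    (N / 8 ≤ d → N * |(|y| - d)| * (|(|y| - d)| + N) ^ 3 / 2048 ≤
      5 * N * (|(|y| - d)| * (|y| + d) * (y ^ 2 + x + d ^ 2))) := by
  set z := |(|y| - d)| with hz
  have hy : 0 ≤ |y| := abs_nonneg y
  have hz0 : 0 ≤ z := abs_nonneg _
  have hzw : z ≤ |y| + d := by rw [hz, abs_le]; constructor <;> linarith
  set w := |y| + d with hw
  have hw2 : w ^ 2 / 2 ≤ y ^ 2 + x + d ^ 2 := by
    rw [← sq_abs y]; nlinarith [sq_nonneg (|y| - d)]
  have hmain : N * z * (w ^ 3 / 2) ≤ N * (z * w * (y ^ 2 + x + d ^ 2)) := by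
    calc N * z * (w ^ 3 / 2) = N * (z * w * (w ^ 2 / 2)) := by ring
      _ ≤ _ := by gcongr
  constructor
  · have : z ^ 3 ≤ w ^ 3 := by gcongr
    have : N * z * (z ^ 3 / 2) ≤ N * z * (w ^ 3 / 2) := by gcongr
    nlinarith
  · intro hNd
    have h1 : z + N ≤ 9 * w := by linarith
    have h2 : (z + N) ^ 3 ≤ (9 * w) ^ 3 := by gcongr
    have h3 : (z + N) ^ 3 / 2048 ≤ 5 * (w ^ 3 / 2) := by
      have : 0 ≤ w ^ 3 := by positivity
      nlinarith
    calc N * z * (z + N) ^ 3 / 2048 = N * z * ((z + N) ^ 3 / 2048) := by ring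
      _ ≤ N * z * (5 * (w ^ 3 / 2)) := by gcongr
      _ = 5 * (N * z * (w ^ 3 / 2)) := by ring
      _ ≤ _ := by linarith

lemma bracket_four (z : ℝ) (hz : 0 ≤ z) : (1 + z) ^ 4 / 8 ≤ 1 + z ^ 4 := by
  nlinarith [sq_nonneg (z - 1), sq_nonneg (z ^ 2 - 1), mul_nonneg hz (sq_nonneg (z - 1)), sq_nonneg (z^2 - z)]


lemma lint_base (r m : ℝ) (hr0 : 0 < r) (hr1 : r < 1) (hm : 0 ≤ m) (hrm : 1 < r + m) :
    ∫⁻ u : ℝ, ENNReal.ofReal (|u| ^ (-r) * (1 + |u|) ^ (-m)) ≠ ⊤ := by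
  have h1 : Integrable (fun u : ℝ => (1 + ‖u‖) ^ (-(r + m))) volume :=
    integrable_one_add_norm (by simpa using hrm)
  have h2 : IntegrableOn (fun u : ℝ => |u| ^ (-r)) (Set.Ioc (-1) 1) volume := by
    have hp : IntervalIntegrable (fun u : ℝ => |u| ^ (-r)) volume 0 1 := by
      have := intervalIntegral.intervalIntegrable_rpow' (a := 0) (b := 1) (r := -r) (by linarith)
      refine this.congr ?_
      intro x hx
      rw [Set.uIoc_of_le zero_le_one] at hx
      simp only [abs_of_pos hx.1]
    have hn : IntervalIntegrable (fun u : ℝ => |u| ^ (-r)) volume (-1) 0 := by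
      have h := hp.comp_mul_left (c := -1)
      simp at h
      exact h.symm
    have := hn.trans hp
    rwa [intervalIntegrable_iff_integrableOn_Ioc_of_le (by norm_num)] at this
  have h3 : Integrable ((Set.Ioc (-1 : ℝ) 1).indicator (fun u : ℝ => |u| ^ (-r))) volume :=
    h2.integrable_indicator measurableSet_Ioc
  have h4 := h3.add (h1.const_mul (2 ^ r))
  have h5 := h4.lintegral_lt_top
  refine (lt_of_le_of_lt (lintegral_mono_ae ?_) h5).ne
  have hne : ∀ᵐ u : ℝ, u ≠ -1 := by
    simp [ae_iff, measure_singleton]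
  filter_upwards [hne] with u hu
  apply ENNReal.ofReal_le_ofReal
  simp only [Pi.add_apply]
  have hu0 : 0 ≤ |u| := abs_nonneg u
  by_cases hu1 : |u| ≤ 1
  · have hmem : u ∈ Set.Ioc (-1 : ℝ) 1 := by
      rw [abs_le] at hu1
      exact ⟨lt_of_le_of_ne hu1.1 (Ne.symm hu), hu1.2⟩
    rw [Set.indicator_of_mem hmem]
    have : (1 + |u|) ^ (-m) ≤ 1 := Real.rpow_le_one_of_one_le_of_nonpos (by linarith) (by linarith)
    have h6 : 0 ≤ |u| ^ (-r) := by positivity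
    have h7 : 0 ≤ (2 : ℝ) ^ r * (1 + ‖u‖) ^ (-(r + m)) := by positivity
    nlinarith
  · push Not at hu1
    have h6 : 0 ≤ (Set.Ioc (-1 : ℝ) 1).indicator (fun u : ℝ => |u| ^ (-r)) u :=
      Set.indicator_nonneg (fun x _ => by positivity) u
    have h7 : |u| ^ (-r) ≤ 2 ^ r * (1 + |u|) ^ (-r) := by
      have : (2 * |u|) ^ (-r) ≤ (1 + |u|) ^ (-r) :=
        Real.rpow_le_rpow_of_nonpos (by linarith) (by linarith) (by linarith)
      rw [Real.mul_rpow (by norm_num) hu0, Real.rpow_neg (by norm_num)] at this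
      have h2r : (0 : ℝ) < 2 ^ r := by positivity
      calc |u| ^ (-r) = 2 ^ r * ((2 ^ r)⁻¹ * |u| ^ (-r)) := by field_simp
        _ ≤ _ := by gcongr
    have h8 : (1 + ‖u‖) ^ (-(r + m)) = (1 + |u|) ^ (-r) * (1 + |u|) ^ (-m) := by
      rw [← Real.rpow_add (by positivity), Real.norm_eq_abs]; ring_nf
    rw [h8]
    have : |u| ^ (-r) * (1 + |u|) ^ (-m) ≤ 2 ^ r * (1 + |u|) ^ (-r) * (1 + |u|) ^ (-m) := by gcongr
    linarith

lemma lint_scale (r m R : ℝ) (hR : 0 < R) :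
    ∫⁻ u : ℝ, ENNReal.ofReal (|u| ^ (-r) * (R + |u|) ^ (-m)) =
      ENNReal.ofReal (R ^ (1 - r - m)) *
        ∫⁻ u : ℝ, ENNReal.ofReal (|u| ^ (-r) * (1 + |u|) ^ (-m)) := by
  conv_lhs => rw [← Real.smul_map_volume_mul_left hR.ne']
  rw [lintegral_smul_measure, lintegral_map (by fun_prop) (by fun_prop), smul_eq_mul,
    ← lintegral_const_mul _ (by fun_prop), ← lintegral_const_mul _ (by fun_prop)]
  refine lintegral_congr fun u => ?_
  rw [← ENNReal.ofReal_mul (abs_nonneg _), ← ENNReal.ofReal_mul (by positivity)]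
  congr 1
  rw [abs_mul, abs_of_pos hR, show R + R * |u| = R * (1 + |u|) by ring,
    Real.mul_rpow hR.le (abs_nonneg _), Real.mul_rpow hR.le (by positivity)]
  have : R ^ (1 - r - m) = R * R ^ (-r) * R ^ (-m) := by
    nth_rewrite 2 [← Real.rpow_one R]
    rw [← Real.rpow_add hR, ← Real.rpow_add hR]; ring_nf
  rw [this]; ring

lemma lint_conv (q : ℝ) (hq0 : 1 / 2 < q) (hq1 : q < 1) : ∃ K : ENNReal, K ≠ ⊤ ∧ ∀ c : ℝ,
    ∫⁻ u : ℝ, ENNReal.ofReal ((1 + |u|) ^ (-q) * (1 + |c - u|) ^ (-q)) ≤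
      K * ENNReal.ofReal ((1 + |c|) ^ (1 - 2 * q)) := by
  set K0 := ∫⁻ u : ℝ, ENNReal.ofReal (|u| ^ (-q) * (1 + |u|) ^ (-q)) with hK0
  have hK : K0 ≠ ⊤ := lint_base q q (by linarith) hq1 (by linarith) (by linarith)
  refine ⟨2 * ENNReal.ofReal (4 ^ q) * K0, by finiteness, fun c => ?_⟩
  set S : ℝ → ENNReal := fun u => ENNReal.ofReal (|u| ^ (-q) * ((1 + |c|) + |u|) ^ (-q)) with hS
  have hSm : Measurable S := by fun_prop
  have hSi : ∫⁻ u, S u = ENNReal.ofReal ((1 + |c|) ^ (1 - q - q)) * K0 :=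
    lint_scale q q (1 + |c|) (by positivity)
  have hpt : ∀ u v : ℝ, u ≠ 0 → |u| ≤ |v| → u + v = c →
      (1 + |u|) ^ (-q) * (1 + |v|) ^ (-q) ≤ 4 ^ q * (|u| ^ (-q) * ((1 + |c|) + |u|) ^ (-q)) := by
    intro u v hu huv hc
    have h1 : |c| ≤ |u| + |v| := hc ▸ abs_add_le u v
    have h2 : (1 + |u|) ^ (-q) ≤ |u| ^ (-q) :=
      Real.rpow_le_rpow_of_nonpos (abs_pos.2 hu) (by linarith) (by linarith)
    have hc0 := abs_nonneg c
    have hu0 := abs_nonneg u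
    have h3 : (1 + |v|) ^ (-q) ≤ ((1 + |c| + |u|) / 4) ^ (-q) :=
      Real.rpow_le_rpow_of_nonpos (by positivity) (by linarith) (by linarith)
    have h4 : ((1 + |c| + |u|) / 4) ^ (-q) = 4 ^ q * (1 + |c| + |u|) ^ (-q) := by
      rw [Real.div_rpow (by positivity) (by norm_num), Real.rpow_neg (by norm_num : (0 : ℝ) ≤ 4),
        div_inv_eq_mul, mul_comm]
    rw [h4] at h3
    calc _ ≤ |u| ^ (-q) * (4 ^ q * (1 + |c| + |u|) ^ (-q)) := by gcongr
      _ = _ := by ring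
  have hne0 : ∀ᵐ u : ℝ, u ≠ 0 := by simp [ae_iff, measure_singleton]
  have hnec : ∀ᵐ u : ℝ, u ≠ c := by simp [ae_iff, measure_singleton]
  have hle : ∫⁻ u : ℝ, ENNReal.ofReal ((1 + |u|) ^ (-q) * (1 + |c - u|) ^ (-q)) ≤
      ∫⁻ u : ℝ, ENNReal.ofReal (4 ^ q) * (S u + S (c - u)) := by
    refine lintegral_mono_ae ?_
    filter_upwards [hne0, hnec] with u h0 hcu
    simp only [hS]
    rcases le_total |u| |c - u| with h | h
    · refine le_trans (ENNReal.ofReal_le_ofReal (hpt u (c - u) h0 h (by ring))) ?_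
      rw [ENNReal.ofReal_mul (by positivity)]
      gcongr
      exact le_self_add
    · have := hpt (c - u) u (sub_ne_zero.2 (Ne.symm hcu)) h (by ring)
      rw [mul_comm ((1 + |c - u|) ^ (-q))] at this
      refine le_trans (ENNReal.ofReal_le_ofReal this) ?_
      rw [ENNReal.ofReal_mul (by positivity)]
      gcongr
      exact le_add_self
  refine hle.trans ?_
  rw [lintegral_const_mul _ (by fun_prop), lintegral_add_left hSm,
    lintegral_sub_left_eq_self, hSi, show 1 - q - q = 1 - 2 * q by ring]
  apply le_of_eq
  ring

lemma lint_abs_sub (h : ℝ → ENNReal) (hm : Measurable h) (d : ℝ) (he : ∀ z, h (-z) = h z) :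
    ∫⁻ y : ℝ, h (|y| - d) ≤ 2 * ∫⁻ y : ℝ, h y := by
  calc ∫⁻ y : ℝ, h (|y| - d) ≤ ∫⁻ y : ℝ, (h (y - d) + h (y + d)) := by
        refine lintegral_mono fun y => ?_
        rcases abs_cases y with ⟨h1, _⟩ | ⟨h1, _⟩
        · simp only [h1]; exact le_self_add
        · simp only [h1]
          rw [show -y - d = -(y + d) by ring, he]; exact le_add_self
    _ = _ := by
        rw [lintegral_add_left (by fun_prop), lintegral_sub_right_eq_self,
          lintegral_add_right_eq_self, two_mul]


lemma kernel_y (a b : ℝ) (hb1 : 2 / 5 ≤ b) (hb2 : b < 1 / 2) (ha1 : 0 ≤ a)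
    (ha2 : a ≤ 10 * b - 4) : ∃ K : ENNReal, K ≠ ⊤ ∧ ∀ ξ σ : ℝ,
    ENNReal.ofReal (|ξ| ^ 2 * (1 + |ξ|) ^ (2 * a) * (1 + |σ|) ^ (-(2 * b))) *
      ∫⁻ y : ℝ, ENNReal.ofReal
        ((1 + |σ - ξ ^ 5 + ξ ^ 5 / 16 + 5 / 2 * ξ ^ 3 * y ^ 2 + 5 * ξ * y ^ 4|) ^ (1 - 4 * b)) ≤ K := by
  obtain ⟨p, hp⟩ : ∃ p : ℝ, p = 4 * b - 1 := ⟨_, rfl⟩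
  have hp1 : 3 / 5 ≤ p := by linarith
  have hp2 : p < 1 := by linarith
  have hp' : 1 - 4 * b = -p := by linarith
  rw [hp']
  set K1 := ∫⁻ z : ℝ, ENNReal.ofReal ((1 + |z|) ^ (-(4 * p))) with hK1
  set K2 := ∫⁻ z : ℝ, ENNReal.ofReal (|z| ^ (-p) * (1 + |z|) ^ (-(3 * p))) with hK2
  have hK1t : K1 ≠ ⊤ := by
    have h1 : Integrable (fun u : ℝ => (1 + ‖u‖) ^ (-(4 * p))) volume :=
      integrable_one_add_norm (by simp; linarith)
    exact h1.lintegral_lt_top.ne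
  have hK2t : K2 ≠ ⊤ := lint_base p (3 * p) (by linarith) hp2 (by linarith) (by linarith)
  refine ⟨ENNReal.ofReal (2 ^ (2 * a) * 8 ^ p) * (2 * K1) +
    ENNReal.ofReal (2 ^ (2 * a) * 2 ^ (2 * b) * 8 ^ p) * (2 * K1) +
    ENNReal.ofReal (2 ^ (2 * a) * 2048 ^ p) * (2 * K2), by finiteness, fun ξ σ => ?_⟩
  by_cases hξ : ξ = 0
  · simp [hξ]
  obtain ⟨d, hd0, hd, hdσ⟩ := phase_lower ξ σ hξ
  set N := |ξ| with hN
  have hN0 : 0 < N := abs_pos.2 hξ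
  set E : ℝ → ℝ := fun y => σ - ξ ^ 5 + ξ ^ 5 / 16 + 5 / 2 * ξ ^ 3 * y ^ 2 + 5 * ξ * y ^ 4 with hE
  change ENNReal.ofReal (N ^ 2 * (1 + N) ^ (2 * a) * (1 + |σ|) ^ (-(2 * b))) *
      ∫⁻ y : ℝ, ENNReal.ofReal ((1 + |E y|) ^ (-p)) ≤ _
  replace hd : ∀ y, 5 * N * (|(|y| - d)| * (|y| + d) * (y ^ 2 + ξ ^ 2 / 4 + d ^ 2)) ≤ |E y| := hd
  have hσ1 : (1 + |σ|) ^ (-(2 * b)) ≤ 1 :=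
    Real.rpow_le_one_of_one_le_of_nonpos (by linarith [abs_nonneg σ]) (by linarith)
  -- first bound
  have B1 : ∀ M : ℝ, 0 < M → M ≤ N → M ≤ 1 →
      ∫⁻ y : ℝ, ENNReal.ofReal ((1 + |E y|) ^ (-p)) ≤
        ENNReal.ofReal (M ^ (-p) * 8 ^ p) * (2 * K1) := by
    intro M hM0 hMN hM1
    calc ∫⁻ y : ℝ, ENNReal.ofReal ((1 + |E y|) ^ (-p))
        ≤ ∫⁻ y : ℝ, ENNReal.ofReal (M ^ (-p) * 8 ^ p) *
            ENNReal.ofReal ((1 + |(|y| - d)|) ^ (-(4 * p))) := by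
          refine lintegral_mono fun y => ?_
          rw [← ENNReal.ofReal_mul (by positivity)]
          apply ENNReal.ofReal_le_ofReal
          have h1 := (phase_lower2 N d y (ξ ^ 2 / 4) hN0.le hd0 (by positivity)).1.trans (hd y)
          have hz0 : 0 ≤ |(|y| - d)| := abs_nonneg _
          set z := |(|y| - d)| with hz
          have h2 := bracket_four z hz0
          have hz4 : 0 ≤ z ^ 4 := by positivity
          have h3 : M * ((1 + z) ^ 4 / 8) ≤ 1 + |E y| := by
            calc M * ((1 + z) ^ 4 / 8) ≤ M * (1 + z ^ 4) := by gcongr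
              _ = M + M * z ^ 4 := by ring
              _ ≤ 1 + N * z ^ 4 := by gcongr
              _ ≤ 1 + |E y| := by nlinarith [mul_nonneg hN0.le hz4]
          calc (1 + |E y|) ^ (-p) ≤ (M * ((1 + z) ^ 4 / 8)) ^ (-p) :=
                Real.rpow_le_rpow_of_nonpos (by positivity) h3 (by linarith)
            _ = M ^ (-p) * 8 ^ p * (1 + z) ^ (-(4 * p)) := by
                rw [Real.mul_rpow hM0.le (by positivity), Real.div_rpow (by positivity) (by norm_num),
                  Real.rpow_neg (by norm_num : (0 : ℝ) ≤ 8), div_inv_eq_mul, ← Real.rpow_natCast,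
                  ← Real.rpow_mul (by positivity)]
                push_cast
                rw [show (4 : ℝ) * -p = -(4 * p) by ring]
                ring
      _ = ENNReal.ofReal (M ^ (-p) * 8 ^ p) *
            ∫⁻ y : ℝ, ENNReal.ofReal ((1 + |(|y| - d)|) ^ (-(4 * p))) :=
          lintegral_const_mul _ (by fun_prop)
      _ ≤ _ := by
          gcongr
          exact lint_abs_sub (fun z => ENNReal.ofReal ((1 + |z|) ^ (-(4 * p)))) (by fun_prop) d
            (fun z => by simp)
  rcases le_total N 1 with hN1 | hN1
  · -- low frequency
    have h1 : N ^ 2 * (1 + N) ^ (2 * a) * (1 + |σ|) ^ (-(2 * b)) * (N ^ (-p) * 8 ^ p) ≤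
        2 ^ (2 * a) * 8 ^ p := by
      have h2 : (1 + N) ^ (2 * a) ≤ 2 ^ (2 * a) :=
        Real.rpow_le_rpow (by positivity) (by linarith) (by linarith)
      have h3 : N ^ 2 * N ^ (-p) ≤ 1 := by
        rw [← Real.rpow_natCast, ← Real.rpow_add hN0]
        exact Real.rpow_le_one hN0.le hN1 (by push_cast; linarith)
      calc _ = (N ^ 2 * N ^ (-p)) * (1 + N) ^ (2 * a) * (1 + |σ|) ^ (-(2 * b)) * 8 ^ p := by ring
        _ ≤ 1 * 2 ^ (2 * a) * 1 * 8 ^ p := by gcongr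
        _ = _ := by ring
    calc _ ≤ ENNReal.ofReal (N ^ 2 * (1 + N) ^ (2 * a) * (1 + |σ|) ^ (-(2 * b))) *
          (ENNReal.ofReal (N ^ (-p) * 8 ^ p) * (2 * K1)) := by
            gcongr
            exact B1 N hN0 le_rfl hN1
      _ ≤ ENNReal.ofReal (2 ^ (2 * a) * 8 ^ p) * (2 * K1) := by
            rw [← mul_assoc, ← ENNReal.ofReal_mul (by positivity)]
            gcongr
      _ ≤ _ := by rw [add_assoc]; exact le_self_add
  have hNa : N ^ 2 * (1 + N) ^ (2 * a) ≤ 2 ^ (2 * a) * N ^ (2 + 2 * a) := by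
    have h2 : (1 + N) ^ (2 * a) ≤ (2 * N) ^ (2 * a) :=
      Real.rpow_le_rpow (by positivity) (by linarith) (by linarith)
    rw [Real.mul_rpow (by norm_num) hN0.le] at h2
    rw [Real.rpow_add hN0]
    calc _ ≤ N ^ 2 * (2 ^ (2 * a) * N ^ (2 * a)) := by gcongr
      _ = _ := by norm_num; ring
  by_cases hdN : d < N / 8
  · have h1 : N ^ 2 * (1 + N) ^ (2 * a) * (1 + |σ|) ^ (-(2 * b)) * ((1 : ℝ) ^ (-p) * 8 ^ p) ≤
        2 ^ (2 * a) * 2 ^ (2 * b) * 8 ^ p := by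
      have h2 : (1 + |σ|) ^ (-(2 * b)) ≤ 2 ^ (2 * b) * N ^ (-(10 * b)) := by
        have h3 : (1 + |σ|) ^ (-(2 * b)) ≤ (N ^ 5 / 2) ^ (-(2 * b)) :=
          Real.rpow_le_rpow_of_nonpos (by positivity) (by linarith [hdσ hdN]) (by linarith)
        rw [Real.div_rpow (by positivity) (by norm_num), Real.rpow_neg (by norm_num : (0 : ℝ) ≤ 2),
          div_inv_eq_mul, ← Real.rpow_natCast, ← Real.rpow_mul hN0.le] at h3
        push_cast at h3
        rw [show (5 : ℝ) * -(2 * b) = -(10 * b) by ring] at h3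
        linarith [mul_comm (N ^ (-(10 * b))) ((2 : ℝ) ^ (2 * b))]
      have h4 : N ^ (2 + 2 * a) * N ^ (-(10 * b)) ≤ 1 := by
        rw [← Real.rpow_add hN0]
        exact Real.rpow_le_one_of_one_le_of_nonpos hN1 (by linarith)
      rw [Real.one_rpow, one_mul]
      calc _ ≤ (2 ^ (2 * a) * N ^ (2 + 2 * a)) * (2 ^ (2 * b) * N ^ (-(10 * b))) * 8 ^ p := by gcongr
        _ = 2 ^ (2 * a) * 2 ^ (2 * b) * 8 ^ p * (N ^ (2 + 2 * a) * N ^ (-(10 * b))) := by ring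
        _ ≤ 2 ^ (2 * a) * 2 ^ (2 * b) * 8 ^ p * 1 := by gcongr
        _ = _ := by ring
    calc _ ≤ ENNReal.ofReal (N ^ 2 * (1 + N) ^ (2 * a) * (1 + |σ|) ^ (-(2 * b))) *
          (ENNReal.ofReal ((1 : ℝ) ^ (-p) * 8 ^ p) * (2 * K1)) := by
            gcongr
            exact B1 1 one_pos hN1 le_rfl
      _ ≤ ENNReal.ofReal (2 ^ (2 * a) * 2 ^ (2 * b) * 8 ^ p) * (2 * K1) := by
            rw [← mul_assoc, ← ENNReal.ofReal_mul (by positivity)]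
            gcongr
      _ ≤ _ := by rw [add_right_comm]; exact le_add_self
  · push Not at hdN
    have B2 : ∫⁻ y : ℝ, ENNReal.ofReal ((1 + |E y|) ^ (-p)) ≤
        ENNReal.ofReal (2048 ^ p * N ^ (-p)) * (2 * (ENNReal.ofReal (N ^ (1 - p - 3 * p)) * K2)) := by
      have hne1 : ∀ᵐ y : ℝ, y ≠ d := by simp [ae_iff, measure_singleton]
      have hne2 : ∀ᵐ y : ℝ, y ≠ -d := by simp [ae_iff, measure_singleton]
      calc ∫⁻ y : ℝ, ENNReal.ofReal ((1 + |E y|) ^ (-p))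
        ≤ ∫⁻ y : ℝ, ENNReal.ofReal (2048 ^ p * N ^ (-p)) *
            ENNReal.ofReal (|(|y| - d)| ^ (-p) * (N + |(|y| - d)|) ^ (-(3 * p))) := by
              refine lintegral_mono_ae ?_
              filter_upwards [hne1, hne2] with y hy1 hy2
              rw [← ENNReal.ofReal_mul (by positivity)]
              apply ENNReal.ofReal_le_ofReal
              have h1 := ((phase_lower2 N d y (ξ ^ 2 / 4) hN0.le hd0 (by positivity)).2 hdN).trans (hd y)
              have hz0 : 0 < |(|y| - d)| := by
                rw [abs_pos, sub_ne_zero]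
                intro h
                rcases abs_cases y with ⟨h', _⟩ | ⟨h', _⟩
                · exact hy1 (by linarith)
                · exact hy2 (by linarith)
              set z := |(|y| - d)| with hz
              calc (1 + |E y|) ^ (-p) ≤ (N * z * (z + N) ^ 3 / 2048) ^ (-p) :=
                    Real.rpow_le_rpow_of_nonpos (by positivity) (by linarith) (by linarith)
                _ = 2048 ^ p * N ^ (-p) * (z ^ (-p) * (N + z) ^ (-(3 * p))) := by
                    rw [Real.div_rpow (by positivity) (by norm_num),
                      Real.rpow_neg (by norm_num : (0 : ℝ) ≤ 2048), div_inv_eq_mul,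
                      Real.mul_rpow (by positivity) (by positivity), Real.mul_rpow hN0.le hz0.le,
                      ← Real.rpow_natCast, ← Real.rpow_mul (by positivity)]
                    push_cast
                    rw [show (3 : ℝ) * -p = -(3 * p) by ring, add_comm z N]
                    ring
        _ = ENNReal.ofReal (2048 ^ p * N ^ (-p)) *
              ∫⁻ y : ℝ, ENNReal.ofReal (|(|y| - d)| ^ (-p) * (N + |(|y| - d)|) ^ (-(3 * p))) :=
            lintegral_const_mul _ (by fun_prop)
        _ ≤ _ := by
            gcongr
            rw [hK2, ← lint_scale p (3 * p) N hN0]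
            exact lint_abs_sub (fun z => ENNReal.ofReal (|z| ^ (-p) * (N + |z|) ^ (-(3 * p))))
              (by fun_prop) d (fun z => by simp)
    have h1 : N ^ 2 * (1 + N) ^ (2 * a) * (1 + |σ|) ^ (-(2 * b)) *
        (2048 ^ p * N ^ (-p)) * N ^ (1 - p - 3 * p) ≤ 2 ^ (2 * a) * 2048 ^ p := by
      have h4 : N ^ (2 + 2 * a) * N ^ (-p) * N ^ (1 - p - 3 * p) ≤ 1 := by
        rw [← Real.rpow_add hN0, ← Real.rpow_add hN0]
        exact Real.rpow_le_one_of_one_le_of_nonpos hN1 (by linarith)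
      calc _ ≤ (2 ^ (2 * a) * N ^ (2 + 2 * a)) * 1 * (2048 ^ p * N ^ (-p)) *
              N ^ (1 - p - 3 * p) := by gcongr
        _ = 2 ^ (2 * a) * 2048 ^ p * (N ^ (2 + 2 * a) * N ^ (-p) * N ^ (1 - p - 3 * p)) := by ring
        _ ≤ 2 ^ (2 * a) * 2048 ^ p * 1 := by gcongr
        _ = _ := by ring
    calc _ ≤ ENNReal.ofReal (N ^ 2 * (1 + N) ^ (2 * a) * (1 + |σ|) ^ (-(2 * b))) *
          (ENNReal.ofReal (2048 ^ p * N ^ (-p)) *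
            (2 * (ENNReal.ofReal (N ^ (1 - p - 3 * p)) * K2))) := by gcongr
      _ = ENNReal.ofReal (N ^ 2 * (1 + N) ^ (2 * a) * (1 + |σ|) ^ (-(2 * b)) *
            (2048 ^ p * N ^ (-p)) * N ^ (1 - p - 3 * p)) * (2 * K2) := by
            rw [ENNReal.ofReal_mul (p := _ * (2048 ^ p * N ^ (-p))) (by positivity),
              ENNReal.ofReal_mul (q := 2048 ^ p * N ^ (-p)) (by positivity)]
            ring
      _ ≤ ENNReal.ofReal (2 ^ (2 * a) * 2048 ^ p) * (2 * K2) := by gcongr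
      _ ≤ _ := le_add_self

lemma kernel_bound (a b : ℝ) (hb1 : 2 / 5 ≤ b) (hb2 : b < 1 / 2) (ha1 : 0 ≤ a)
    (ha2 : a ≤ 10 * b - 4) : ∃ K : ENNReal, K ≠ ⊤ ∧ ∀ ξ τ : ℝ,
    ENNReal.ofReal (|ξ| ^ 2 * (1 + |ξ|) ^ (2 * a) * (1 + |τ + ξ ^ 5|) ^ (-(2 * b))) *
      ∫⁻ q : ℝ × ℝ, ENNReal.ofReal
        ((1 + |q.2 + q.1 ^ 5|) ^ (-(2 * b)) *
          (1 + |(τ - q.2) + (ξ - q.1) ^ 5|) ^ (-(2 * b))) ≤ K := by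
  obtain ⟨K, hK, hKb⟩ := kernel_y a b hb1 hb2 ha1 ha2
  obtain ⟨L, hL, hLb⟩ := lint_conv (2 * b) (by linarith) (by linarith)
  refine ⟨L * K, by finiteness, fun ξ τ => ?_⟩
  have h1 : ∫⁻ q : ℝ × ℝ, ENNReal.ofReal
        ((1 + |q.2 + q.1 ^ 5|) ^ (-(2 * b)) *
          (1 + |(τ - q.2) + (ξ - q.1) ^ 5|) ^ (-(2 * b))) ≤
      L * ∫⁻ y : ℝ, ENNReal.ofReal
        ((1 + |(τ + ξ ^ 5) - ξ ^ 5 + ξ ^ 5 / 16 + 5 / 2 * ξ ^ 3 * y ^ 2 + 5 * ξ * y ^ 4|) ^ (1 - 4 * b)) := by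
    rw [Measure.volume_eq_prod, lintegral_prod _ (by fun_prop)]
    calc _ ≤ ∫⁻ x : ℝ, L * ENNReal.ofReal ((1 + |τ + x ^ 5 + (ξ - x) ^ 5|) ^ (1 - 4 * b)) := by
          refine lintegral_mono fun x => ?_
          have h2 := hLb (τ + x ^ 5 + (ξ - x) ^ 5)
          rw [← lintegral_add_right_eq_self _ (x ^ 5), show 1 - 2 * (2 * b) = 1 - 4 * b by ring] at h2
          refine le_trans (le_of_eq (lintegral_congr fun u => ?_)) h2
          rw [show τ + x ^ 5 + (ξ - x) ^ 5 - (u + x ^ 5) = τ - u + (ξ - x) ^ 5 by ring]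
      _ = L * ∫⁻ x : ℝ, ENNReal.ofReal ((1 + |τ + x ^ 5 + (ξ - x) ^ 5|) ^ (1 - 4 * b)) :=
          lintegral_const_mul _ (by fun_prop)
      _ = _ := by
          rw [← lintegral_add_right_eq_self _ (ξ / 2)]
          congr 1
          refine lintegral_congr fun y => ?_
          congr 4
          ring
  calc _ ≤ _ := mul_le_mul_right h1 _
    _ = L * (ENNReal.ofReal (|ξ| ^ 2 * (1 + |ξ|) ^ (2 * a) * (1 + |τ + ξ ^ 5|) ^ (-(2 * b))) * _) := by
        rw [mul_left_comm]
    _ ≤ L * K := mul_le_mul_right (hKb ξ (τ + ξ ^ 5)) _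

end KernelPart

section Assembly
open scoped SchwartzMap

lemma cs_sq {α : Type*} [MeasurableSpace α] (μ : Measure α) (f g : α → ENNReal)
    (hf : AEMeasurable f μ) (hg : AEMeasurable g μ) :
    (∫⁻ x, f x * g x ∂μ) ^ 2 ≤ (∫⁻ x, f x ^ 2 ∂μ) * ∫⁻ x, g x ^ 2 ∂μ := by
  have h := ENNReal.lintegral_mul_le_Lp_mul_Lq μ Real.HolderConjugate.two_two hf hg
  have h2 := pow_le_pow_left' h 2
  refine h2.trans (le_of_eq ?_)
  rw [mul_pow, ← ENNReal.rpow_natCast, ← ENNReal.rpow_natCast, ← ENNReal.rpow_mul,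
    ← ENNReal.rpow_mul]
  norm_num

noncomputable def wA (s : ℝ) (q : ℝ × ℝ) : ENNReal := ENNReal.ofReal ((1 + |q.1|) ^ s)
noncomputable def wB (b : ℝ) (q : ℝ × ℝ) : ENNReal := ENNReal.ofReal ((1 + |q.2 + q.1 ^ 5|) ^ b)

lemma wA_meas (s : ℝ) : Measurable (wA s) := by unfold wA; fun_prop
lemma wB_meas (b : ℝ) : Measurable (wB b) := by unfold wB; fun_prop

lemma wA_add (s a : ℝ) (q : ℝ × ℝ) : wA (s + a) q = wA s q * wA a q := by
  unfold wA
  rw [← ENNReal.ofReal_mul (by positivity), Real.rpow_add (by positivity)]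

lemma wB_add (s a : ℝ) (q : ℝ × ℝ) : wB (s + a) q = wB s q * wB a q := by
  unfold wB
  rw [← ENNReal.ofReal_mul (by positivity), Real.rpow_add (by positivity)]

lemma wB_cancel (b : ℝ) (q : ℝ × ℝ) : wB (-b) q * wB b q = 1 := by
  rw [← wB_add]; simp [wB]

lemma wA_sub (s : ℝ) (hs : 0 ≤ s) (p q : ℝ × ℝ) : wA s p ≤ wA s q * wA s (p - q) := by
  unfold wA
  rw [← ENNReal.ofReal_mul (by positivity), ← Real.mul_rpow (by positivity) (by positivity)]
  apply ENNReal.ofReal_le_ofReal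
  refine Real.rpow_le_rpow (by positivity) ?_ hs
  have h1 : |p.1| ≤ |q.1| + |(p - q).1| := by
    have := abs_add_le q.1 (p - q).1
    simpa using this
  nlinarith [abs_nonneg q.1, abs_nonneg (p - q).1, mul_nonneg (abs_nonneg q.1) (abs_nonneg (p - q).1)]

lemma bilin_pointwise (s b a : ℝ) (hs : 0 ≤ s) (hb1 : 2 / 5 ≤ b) (hb2 : b < 1 / 2) (ha1 : 0 ≤ a)
    (ha2 : a ≤ 10 * b - 4) : ∃ K : ENNReal, K ≠ ⊤ ∧
    ∀ (F G : ℝ × ℝ → ENNReal), Measurable F → Measurable G → ∀ p : ℝ × ℝ,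
    wA (s + a) p ^ 2 * wB (-b) p ^ 2 * (‖p.1‖ₑ * ∫⁻ q, F q * G (p - q)) ^ 2 ≤
      K * ∫⁻ q, (wA s q * wB b q * F q) ^ 2 * (wA s (p - q) * wB b (p - q) * G (p - q)) ^ 2 := by
  obtain ⟨K, hK, hKb⟩ := kernel_bound a b hb1 hb2 ha1 ha2
  refine ⟨K, hK, fun F G hF hG p => ?_⟩
  have hA := wA_meas s
  have hB := wB_meas b
  have hBi := wB_meas (-b)
  have hsub : Measurable fun q : ℝ × ℝ => p - q := by fun_prop
  have hA' := hA.comp hsub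
  have hB' := hB.comp hsub
  have hBi' := hBi.comp hsub
  have hG' := hG.comp hsub
  have h1 : wA s p * ∫⁻ q, F q * G (p - q) ≤
      ∫⁻ q, (wB (-b) q * wB (-b) (p - q)) *
        ((wA s q * wB b q * F q) * (wA s (p - q) * wB b (p - q) * G (p - q))) := by
    have hFG : Measurable (fun q => F q * G (p - q)) := hF.mul hG'
    rw [← lintegral_const_mul _ hFG]
    refine lintegral_mono fun q => ?_
    calc wA s p * (F q * G (p - q)) ≤ (wA s q * wA s (p - q)) * (F q * G (p - q)) := by
          gcongr; exact wA_sub s hs p q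
      _ = (wB (-b) q * wB b q) * (wB (-b) (p - q) * wB b (p - q)) *
          ((wA s q * wA s (p - q)) * (F q * G (p - q))) := by
          rw [wB_cancel, wB_cancel]; ring
      _ = _ := by ring
  have h2 := cs_sq volume (fun q => wB (-b) q * wB (-b) (p - q))
    (fun q => (wA s q * wB b q * F q) * (wA s (p - q) * wB b (p - q) * G (p - q)))
    (hBi.mul hBi').aemeasurable (((hA.mul hB).mul hF).mul ((hA'.mul hB').mul hG')).aemeasurable
  simp only [mul_pow (wA s _ * wB b _ * F _)] at h2
  have h3 : wA a p ^ 2 * wB (-b) p ^ 2 * ‖p.1‖ₑ ^ 2 *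
      ∫⁻ q, (wB (-b) q * wB (-b) (p - q)) ^ 2 ≤ K := by
    refine le_trans (le_of_eq ?_) (hKb p.1 p.2)
    congr 1
    · unfold wA wB
      rw [Real.enorm_eq_ofReal_abs, ← ENNReal.ofReal_pow (by positivity),
        ← ENNReal.ofReal_pow (by positivity), ← ENNReal.ofReal_pow (by positivity),
        ← ENNReal.ofReal_mul (by positivity), ← ENNReal.ofReal_mul (by positivity)]
      congr 1
      rw [← Real.rpow_mul_natCast (by positivity), ← Real.rpow_mul_natCast (by positivity)]
      push_cast
      rw [show -b * 2 = -(2 * b) by ring, mul_comm a 2]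
      ring
    · refine lintegral_congr fun q => ?_
      unfold wB
      rw [← ENNReal.ofReal_mul (by positivity), ← ENNReal.ofReal_pow (by positivity)]
      congr 1
      rw [mul_pow, ← Real.rpow_mul_natCast (by positivity), ← Real.rpow_mul_natCast (by positivity)]
      push_cast
      rw [show -b * 2 = -(2 * b) by ring]
      rfl
  calc wA (s + a) p ^ 2 * wB (-b) p ^ 2 * (‖p.1‖ₑ * ∫⁻ q, F q * G (p - q)) ^ 2
      = wA a p ^ 2 * wB (-b) p ^ 2 * ‖p.1‖ₑ ^ 2 * (wA s p * ∫⁻ q, F q * G (p - q)) ^ 2 := by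
        rw [wA_add]; ring
    _ ≤ wA a p ^ 2 * wB (-b) p ^ 2 * ‖p.1‖ₑ ^ 2 * (_ * _) :=
        mul_le_mul_right ((pow_le_pow_left' h1 2).trans h2) _
    _ = (wA a p ^ 2 * wB (-b) p ^ 2 * ‖p.1‖ₑ ^ 2 * _) * _ := by rw [← mul_assoc]
    _ ≤ _ := mul_le_mul_left h3 _

lemma conv_lint (f g : ℝ × ℝ → ENNReal) (hf : Measurable f) (hg : Measurable g) :
    ∫⁻ p : ℝ × ℝ, ∫⁻ q : ℝ × ℝ, f q * g (p - q) = (∫⁻ q, f q) * ∫⁻ q, g q := by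
  rw [lintegral_lintegral_swap]
  · rw [← lintegral_mul_const _ hf]
    refine lintegral_congr fun q => ?_
    have hgq : Measurable (fun x : ℝ × ℝ => g (x - q)) := hg.comp (measurable_id.sub_const q)
    rw [lintegral_const_mul _ hgq, lintegral_sub_right_eq_self g q]
  · exact ((hf.comp measurable_snd).mul (hg.comp (measurable_fst.sub measurable_snd))).aemeasurable

noncomputable def Xint (s b : ℝ) (v : 𝓢(ℝ × ℝ, ℂ)) (p : ℝ × ℝ) : ℝ :=
  (1 + |p.1|) ^ (2 * s) * (1 + |p.2 + p.1 ^ 5|) ^ (2 * b) * ‖FS v p‖ ^ 2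

lemma Xint_integrable (s b : ℝ) (hs : 0 ≤ s) (hb : 0 ≤ b) (v : 𝓢(ℝ × ℝ, ℂ)) :
    Integrable (Xint s b v) volume := by
  obtain ⟨K, hK⟩ := exists_nat_ge (2 * s + 5 * (2 * b))
  obtain ⟨M, hM⟩ : ∃ M : ℝ, ∀ p, ‖FS v p‖ ≤ M := ⟨_, fun p => SchwartzMap.norm_le_seminorm ℝ (FS v) p⟩
  have hM0 : 0 ≤ M := (norm_nonneg _).trans (hM 0)
  have h1 : Integrable (fun p : ℝ × ℝ => 2 ^ (K - 1) * M * (‖FS v p‖ + ‖p‖ ^ K * ‖FS v p‖)) volume :=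
    ((FS v).integrable.norm.add ((FS v).integrable_pow_mul volume K)).const_mul _
  refine h1.mono' ?_ (Filter.Eventually.of_forall fun p => ?_)
  · have h6 := (FS v).continuous.measurable
    have : Measurable (Xint s b v) := by
      unfold Xint
      have h7 : Measurable fun p : ℝ × ℝ => (1 + |p.1|) ^ (2 * s) * (1 + |p.2 + p.1 ^ 5|) ^ (2 * b) := by
        fun_prop
      exact h7.mul (h6.norm.pow_const 2)
    exact this.aestronglyMeasurable
  · have hx0 : 0 ≤ ‖p‖ := norm_nonneg p
    have hp1 : |p.1| ≤ ‖p‖ := by simpa using norm_fst_le p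
    have hp2 : |p.2| ≤ ‖p‖ := by simpa using norm_snd_le p
    have hX0 : 0 ≤ Xint s b v p := by unfold Xint; positivity
    rw [Real.norm_of_nonneg hX0]
    unfold Xint
    have h2 : (1 + |p.1|) ^ (2 * s) ≤ (1 + ‖p‖) ^ (2 * s) :=
      Real.rpow_le_rpow (by positivity) (by linarith) (by linarith)
    have h3 : 1 + |p.2 + p.1 ^ 5| ≤ (1 + ‖p‖) ^ 5 := by
      have h4 : |p.2 + p.1 ^ 5| ≤ |p.2| + |p.1| ^ 5 := by
        rw [← abs_pow]; exact abs_add_le _ _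
      have h5 : |p.1| ^ 5 ≤ ‖p‖ ^ 5 := by gcongr
      have h6 : (1 + ‖p‖) ^ 5 = 1 + ‖p‖ + ‖p‖ ^ 5 + (4 * ‖p‖ + 10 * ‖p‖ ^ 2 + 10 * ‖p‖ ^ 3 + 5 * ‖p‖ ^ 4) := by
        ring
      have h7 : 0 ≤ 4 * ‖p‖ + 10 * ‖p‖ ^ 2 + 10 * ‖p‖ ^ 3 + 5 * ‖p‖ ^ 4 := by positivity
      linarith
    have h4 : (1 + |p.2 + p.1 ^ 5|) ^ (2 * b) ≤ (1 + ‖p‖) ^ (5 * (2 * b)) := by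
      refine (Real.rpow_le_rpow (by positivity) h3 (by linarith)).trans (le_of_eq ?_)
      rw [← Real.rpow_natCast, ← Real.rpow_mul (by positivity)]
      norm_num
    have h5 : (1 + |p.1|) ^ (2 * s) * (1 + |p.2 + p.1 ^ 5|) ^ (2 * b) ≤ (1 + ‖p‖) ^ K := by
      calc _ ≤ (1 + ‖p‖) ^ (2 * s) * (1 + ‖p‖) ^ (5 * (2 * b)) := by gcongr
        _ = (1 + ‖p‖) ^ (2 * s + 5 * (2 * b)) := by rw [Real.rpow_add (by positivity)]
        _ ≤ (1 + ‖p‖) ^ (K : ℝ) := Real.rpow_le_rpow_of_exponent_le (by linarith) hK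
        _ = _ := Real.rpow_natCast _ _
    have h6 : (1 + ‖p‖) ^ K ≤ 2 ^ (K - 1) * (1 ^ K + ‖p‖ ^ K) := add_pow_le zero_le_one hx0 K
    rw [one_pow] at h6
    have h7 : ‖FS v p‖ ^ 2 ≤ M * ‖FS v p‖ := by
      rw [sq]; exact mul_le_mul_of_nonneg_right (hM p) (norm_nonneg _)
    calc _ ≤ (2 ^ (K - 1) * (1 + ‖p‖ ^ K)) * (M * ‖FS v p‖) :=
          mul_le_mul (h5.trans h6) h7 (by positivity) (by positivity)
      _ = _ := by ring

lemma Xnorm_lint (s b : ℝ) (hs : 0 ≤ s) (hb : 0 ≤ b) (v : 𝓢(ℝ × ℝ, ℂ)) :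
    ∫⁻ q, (wA s q * wB b q * ‖FS v q‖ₑ) ^ 2 =
      ENNReal.ofReal (Xnorm s b (fun x t => v (x, t)) ^ 2) := by
  have hintg := Xint_integrable s b hs hb v
  have h0 : ∀ p, 0 ≤ Xint s b v p := fun p => by unfold Xint; positivity
  have h1 : ∫⁻ q, (wA s q * wB b q * ‖FS v q‖ₑ) ^ 2 = ∫⁻ q, ENNReal.ofReal (Xint s b v q) := by
    refine lintegral_congr fun q => ?_
    unfold wA wB Xint
    rw [← ofReal_norm, ← ENNReal.ofReal_mul (by positivity),
      ← ENNReal.ofReal_mul (by positivity), ← ENNReal.ofReal_pow (by positivity)]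
    congr 1
    rw [mul_pow, mul_pow, ← Real.rpow_mul_natCast (by positivity),
      ← Real.rpow_mul_natCast (by positivity)]
    push_cast
    rw [mul_comm s, mul_comm b]
  rw [h1, ← ofReal_integral_eq_lintegral_ofReal hintg (Filter.Eventually.of_forall h0)]
  congr 1
  unfold Xnorm
  simp_rw [FT2_eq]
  rw [Real.sq_sqrt]
  · rw [Measure.volume_eq_prod] at hintg ⊢
    rw [integral_prod _ hintg]
    rfl
  · refine integral_nonneg fun ξ => integral_nonneg fun τ => ?_
    exact h0 (ξ, τ)

end Assembly

theorem stmt11 (s b a : ℝ) (hs : 0 ≤ s) (hb1 : 2 / 5 ≤ b) (hb2 : b < 1 / 2) (ha1 : 0 ≤ a)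
    (ha2 : a ≤ 10 * b - 4) :
    ∃ C > (0 : ℝ), ∀ v w : SchwartzMap (ℝ × ℝ) ℂ,
      Xnorm (s + a) (-b) (dxProd (⇑v) (⇑w)) ≤
        C * Xnorm s b (fun x t => v (x, t)) * Xnorm s b (fun x t => w (x, t)) := by
  obtain ⟨K, hK, hKb⟩ := bilin_pointwise s b a hs hb1 hb2 ha1 ha2
  obtain ⟨C0, hC0, hC0b⟩ := FT2_dxProd_le
  set D : ENNReal := C0 ^ 2 * K with hD
  have hDt : D ≠ ⊤ := by finiteness
  refine ⟨√(D.toReal) + 1, by positivity, fun v w => ?_⟩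
  set Xv := Xnorm s b (fun x t => v (x, t)) with hXv
  set Xw := Xnorm s b (fun x t => w (x, t)) with hXw
  have hXv0 : 0 ≤ Xv := Real.sqrt_nonneg _
  have hXw0 : 0 ≤ Xw := Real.sqrt_nonneg _
  have hFv : Measurable fun q => ‖FS v q‖ₑ := (FS v).continuous.measurable.enorm
  have hFw : Measurable fun q => ‖FS w q‖ₑ := (FS w).continuous.measurable.enorm
  set f : ℝ × ℝ → ENNReal := fun q => (wA s q * wB b q * ‖FS v q‖ₑ) ^ 2 with hf
  set g : ℝ × ℝ → ENNReal := fun q => (wA s q * wB b q * ‖FS w q‖ₑ) ^ 2 with hg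
  have hfm : Measurable f := (((wA_meas s).mul (wB_meas b)).mul hFv).pow_const 2
  have hgm : Measurable g := (((wA_meas s).mul (wB_meas b)).mul hFw).pow_const 2
  have hpt : ∀ ξ τ : ℝ, ‖(1 + |ξ|) ^ (2 * (s + a)) * (1 + |τ + ξ ^ 5|) ^ (2 * -b) *
      ‖FT2 (dxProd (⇑v) (⇑w)) ξ τ‖ ^ 2‖ₑ ≤ D * ∫⁻ q, f q * g ((ξ, τ) - q) := by
    intro ξ τ
    have h1 : ‖(1 + |ξ|) ^ (2 * (s + a)) * (1 + |τ + ξ ^ 5|) ^ (2 * -b) *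
        ‖FT2 (dxProd (⇑v) (⇑w)) ξ τ‖ ^ 2‖ₑ =
        wA (s + a) (ξ, τ) ^ 2 * wB (-b) (ξ, τ) ^ 2 * ‖FT2 (dxProd (⇑v) (⇑w)) ξ τ‖ₑ ^ 2 := by
      unfold wA wB
      rw [Real.enorm_eq_ofReal (by positivity), ← ofReal_norm,
        ← ENNReal.ofReal_pow (by positivity), ← ENNReal.ofReal_pow (by positivity),
        ← ENNReal.ofReal_pow (by positivity), ← ENNReal.ofReal_mul (by positivity),
        ← ENNReal.ofReal_mul (by positivity)]
      congr 1
      rw [← Real.rpow_mul_natCast (by positivity), ← Real.rpow_mul_natCast (by positivity)]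
      push_cast
      rw [mul_comm (s + a), mul_comm (-b)]
    rw [h1]
    calc _ ≤ wA (s + a) (ξ, τ) ^ 2 * wB (-b) (ξ, τ) ^ 2 *
          (C0 * ‖ξ‖ₑ * ∫⁻ q : ℝ × ℝ, ‖FS v q‖ₑ * ‖FS w ((ξ, τ) - q)‖ₑ) ^ 2 := by
          gcongr; exact hC0b v w ξ τ
      _ = C0 ^ 2 * (wA (s + a) (ξ, τ) ^ 2 * wB (-b) (ξ, τ) ^ 2 *
          (‖ξ‖ₑ * ∫⁻ q : ℝ × ℝ, ‖FS v q‖ₑ * ‖FS w ((ξ, τ) - q)‖ₑ) ^ 2) := by ring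
      _ ≤ C0 ^ 2 * (K * ∫⁻ q, f q * g ((ξ, τ) - q)) :=
          mul_le_mul_right (hKb _ _ hFv hFw (ξ, τ)) _
      _ = _ := by rw [hD, mul_assoc]
  have hcm : Measurable fun p : ℝ × ℝ => ∫⁻ q, f q * g (p - q) :=
    Measurable.lintegral_prod_right'
      ((hfm.comp measurable_snd).mul (hgm.comp (measurable_fst.sub measurable_snd)))
  set I := ∫ ξ : ℝ, ∫ τ : ℝ, (1 + |ξ|) ^ (2 * (s + a)) * (1 + |τ + ξ ^ 5|) ^ (2 * -b) *
      ‖FT2 (dxProd (⇑v) (⇑w)) ξ τ‖ ^ 2 with hI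
  have hI0 : 0 ≤ I := integral_nonneg fun ξ => integral_nonneg fun τ => by positivity
  have hmain : ENNReal.ofReal I ≤ ENNReal.ofReal (D.toReal * (Xv ^ 2 * Xw ^ 2)) := by
    calc ENNReal.ofReal I = ‖I‖ₑ := (Real.enorm_eq_ofReal hI0).symm
      _ ≤ ∫⁻ ξ : ℝ, ‖∫ τ : ℝ, (1 + |ξ|) ^ (2 * (s + a)) * (1 + |τ + ξ ^ 5|) ^ (2 * -b) *
          ‖FT2 (dxProd (⇑v) (⇑w)) ξ τ‖ ^ 2‖ₑ := enorm_integral_le_lintegral_enorm _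
      _ ≤ ∫⁻ ξ : ℝ, ∫⁻ τ : ℝ, D * ∫⁻ q, f q * g ((ξ, τ) - q) := by
          refine lintegral_mono fun ξ => ?_
          exact (enorm_integral_le_lintegral_enorm _).trans (lintegral_mono fun τ => hpt ξ τ)
      _ = ∫⁻ p : ℝ × ℝ, D * ∫⁻ q, f q * g (p - q) := by
          exact (lintegral_prod (μ := volume) (ν := volume)
            (fun p : ℝ × ℝ => D * ∫⁻ q, f q * g (p - q)) (hcm.const_mul D).aemeasurable).symm
      _ = D * ((∫⁻ q, f q) * ∫⁻ q, g q) := by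
          rw [lintegral_const_mul _ hcm, conv_lint f g hfm hgm]
      _ = _ := by
          rw [hf, hg, Xnorm_lint s b hs (by linarith) v, Xnorm_lint s b hs (by linarith) w,
            ENNReal.ofReal_mul (by positivity), ENNReal.ofReal_mul (by positivity),
            ENNReal.ofReal_toReal hDt]
  have hfin : I ≤ D.toReal * (Xv ^ 2 * Xw ^ 2) :=
    (ENNReal.ofReal_le_ofReal_iff (by positivity)).1 hmain
  calc Xnorm (s + a) (-b) (dxProd (⇑v) (⇑w)) = √I := rfl
    _ ≤ √(D.toReal * (Xv ^ 2 * Xw ^ 2)) := Real.sqrt_le_sqrt hfin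
    _ = √(D.toReal) * (Xv * Xw) := by
        rw [Real.sqrt_mul (by positivity), ← mul_pow, Real.sqrt_sq (by positivity)]
    _ ≤ (√(D.toReal) + 1) * (Xv * Xw) := by
        gcongr
        linarith
    _ = _ := by ring
end

section
/- Let φ(x) = e^{-2|x|} and g(x) = e^x e^{-2|x|}. For every t < 0 and every x ∈ ℝ, both integrals below converge absolutely and e^x · (2π)^{-1/2} ∫_ℝ e^{ixξ} e^{-itξ⁵} φ̂(ξ) dξ = (2π)^{-1/2} ∫_ℝ e^{ixξ} e^{-t(iξ-1)⁵} ĝ(ξ) dξ. That is, the Fourier transform of x ↦ e^x (W(t)φ)(x) equals ξ ↦ e^{-t(iξ-1)⁵} ĝ(ξ). -/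
open MeasureTheory
open scoped Real

/-- Fourier transform on ℝ: `f̂(ξ) = (2π)^{-1/2} ∫ e^{-iξx} f(x) dx`. -/
noncomputable def FT1 (f : ℝ → ℂ) (ξ : ℝ) : ℂ :=
  (Real.sqrt (2 * π) : ℂ)⁻¹ * ∫ x : ℝ, Complex.exp (-Complex.I * ξ * x) * f x

/-- `φ(x) = e^{-2|x|}`. -/
noncomputable def phi (x : ℝ) : ℂ := (Real.exp (-2 * |x|) : ℂ)

/-- `g(x) = eˣ e^{-2|x|}`. -/
noncomputable def gfun (x : ℝ) : ℂ := ((Real.exp x * Real.exp (-2 * |x|) : ℝ) : ℂ)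

open Complex in
lemma aux_two_sided (f : ℝ → ℂ) (a b : ℂ) (ha : a.re < 0) (hb : 0 < b.re)
    (h1 : ∀ x : ℝ, 0 < x → f x = Complex.exp (a * x))
    (h2 : ∀ x : ℝ, x ≤ 0 → f x = Complex.exp (b * x)) :
    ∫ x : ℝ, f x = 1 / b - 1 / a := by
  have e1 : Set.EqOn f (fun x : ℝ => Complex.exp (a * x)) (Set.Ioi 0) := fun x hx => h1 x hx
  have e2 : Set.EqOn f (fun x : ℝ => Complex.exp (b * x)) (Set.Iic 0) := fun x hx => h2 x hx
  rw [← intervalIntegral.integral_Iic_add_Ioi (b := 0)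
    ((integrableOn_exp_mul_complex_Iic hb 0).congr_fun e2.symm measurableSet_Iic)
    ((integrableOn_exp_mul_complex_Ioi ha 0).congr_fun e1.symm measurableSet_Ioi),
    setIntegral_congr_fun measurableSet_Iic e2, setIntegral_congr_fun measurableSet_Ioi e1,
    integral_exp_mul_complex_Iic hb, integral_exp_mul_complex_Ioi ha]
  simp only [ofReal_zero, mul_zero, Complex.exp_zero]
  ring

lemma aux_den (ξ y : ℝ) (h0 : 0 ≤ y) (h1 : y ≤ 1) :
    1 + ξ ^ 2 ≤ ‖((ξ : ℂ) + y * Complex.I) ^ 2 + 4‖ := by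
  refine le_trans ?_ (Complex.re_le_norm _)
  have : ((((ξ : ℂ) + y * Complex.I) ^ 2 + 4).re) = ξ ^ 2 - y ^ 2 + 4 := by
    simp [pow_two]
  rw [this]
  nlinarith

lemma aux_den_ne (ξ y : ℝ) (h0 : 0 ≤ y) (h1 : y ≤ 1) :
    ((ξ : ℂ) + y * Complex.I) ^ 2 + 4 ≠ 0 := by
  rw [← norm_pos_iff]
  have := aux_den ξ y h0 h1
  nlinarith [sq_nonneg ξ]

lemma aux_FT_phi (ξ : ℝ) : FT1 phi ξ =
    (Real.sqrt (2 * π) : ℂ)⁻¹ * (4 / (((ξ : ℂ) + (0 : ℝ) * Complex.I) ^ 2 + 4)) := by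
  unfold FT1
  rw [aux_two_sided _ (-Complex.I * ξ - 2) (-Complex.I * ξ + 2) (by simp) (by simp)]
  · congr 1
    have h := aux_den_ne ξ 0 le_rfl zero_le_one
    have e : ((ξ : ℂ) + (0 : ℝ) * Complex.I) ^ 2 + 4
        = -((-Complex.I * ξ - 2) * (-Complex.I * ξ + 2)) := by
      push_cast
      linear_combination ((ξ : ℂ) ^ 2) * Complex.I_sq
    rw [e] at h ⊢
    have h' := neg_ne_zero.mp h
    have ha := left_ne_zero_of_mul h'
    have hb := right_ne_zero_of_mul h'
    rw [div_neg, div_sub_div _ _ hb ha, ← neg_div]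
    congr 1 <;> ring
  · intro x hx
    rw [phi, abs_of_pos hx, Complex.ofReal_exp, ← Complex.exp_add]
    congr 1
    push_cast
    ring
  · intro x hx
    rw [phi, abs_of_nonpos hx, Complex.ofReal_exp, ← Complex.exp_add]
    congr 1
    push_cast
    ring

lemma aux_FT_g (ξ : ℝ) : FT1 gfun ξ =
    (Real.sqrt (2 * π) : ℂ)⁻¹ * (4 / (((ξ : ℂ) + (1 : ℝ) * Complex.I) ^ 2 + 4)) := by
  unfold FT1
  rw [aux_two_sided _ (-Complex.I * ξ - 1) (-Complex.I * ξ + 3) (by simp) (by simp)]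
  · congr 1
    have h := aux_den_ne ξ 1 zero_le_one le_rfl
    have e : ((ξ : ℂ) + (1 : ℝ) * Complex.I) ^ 2 + 4
        = -((-Complex.I * ξ - 1) * (-Complex.I * ξ + 3)) := by
      push_cast
      linear_combination (1 + (ξ : ℂ) ^ 2) * Complex.I_sq
    rw [e] at h ⊢
    have h' := neg_ne_zero.mp h
    have ha := left_ne_zero_of_mul h'
    have hb := right_ne_zero_of_mul h'
    rw [div_neg, div_sub_div _ _ hb ha, ← neg_div]
    congr 1 <;> ring
  · intro x hx
    rw [gfun, abs_of_pos hx, ← Real.exp_add, Complex.ofReal_exp, ← Complex.exp_add]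
    congr 1
    push_cast
    ring
  · intro x hx
    rw [gfun, abs_of_nonpos hx, ← Real.exp_add, Complex.ofReal_exp, ← Complex.exp_add]
    congr 1
    push_cast
    ring

/-- The holomorphic integrand. -/
noncomputable def auxG (t x : ℝ) (z : ℂ) : ℂ :=
  Complex.exp (Complex.I * x * z) * Complex.exp (-Complex.I * t * z ^ 5) * (4 / (z ^ 2 + 4))

lemma aux_bound (t x ξ y : ℝ) (ht : t < 0) (h0 : 0 ≤ y) (h1 : y ≤ 1) :
    ‖auxG t x ((ξ : ℂ) + y * Complex.I)‖
      ≤ (Real.exp |x| * Real.exp (-4 * t) * 4) * (1 + ξ ^ 2)⁻¹ := by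
  have hd := aux_den ξ y h0 h1
  have hp : 0 < 1 + ξ ^ 2 := by positivity
  have r1 : (Complex.I * x * ((ξ : ℂ) + y * Complex.I)).re = - (x * y) := by
    simp
  have r2 : (-Complex.I * t * ((ξ : ℂ) + y * Complex.I) ^ 5).re
      = t * (5 * ξ ^ 4 * y - 10 * ξ ^ 2 * y ^ 3 + y ^ 5) := by
    have : -Complex.I * t * ((ξ : ℂ) + y * Complex.I) ^ 5
       = ((t * (5 * ξ ^ 4 * y - 10 * ξ ^ 2 * y ^ 3 + y ^ 5) : ℝ) : ℂ)
        + ((-t * (ξ ^ 5 - 10 * ξ ^ 3 * y ^ 2 + 5 * ξ * y ^ 4) : ℝ) : ℂ) * Complex.I := by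
      push_cast
      have i2 := Complex.I_sq
      have i3 : Complex.I ^ 3 = -Complex.I := by rw [pow_succ, i2]; ring
      have i4 : Complex.I ^ 4 = 1 := Complex.I_pow_four
      have i5 : Complex.I ^ 5 = Complex.I := by rw [pow_succ, i4]; ring
      have i6 : Complex.I ^ 6 = -1 := by rw [pow_succ, i5]; simp
      ring_nf
      simp only [i2, i3, i4, i5, i6]
      ring
    rw [this, Complex.add_re, Complex.re_ofReal_mul, Complex.ofReal_re, Complex.I_re]
    ring
  unfold auxG
  rw [norm_mul, norm_mul, norm_div, Complex.norm_exp, Complex.norm_exp, r1, r2, mul_assoc (_ * _),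
    ← div_eq_mul_inv]
  have n4 : ‖(4 : ℂ)‖ = 4 := by simp
  rw [n4]
  have b1 : -(x * y) ≤ |x| := by
    have : |x * y| ≤ |x| := by
      rw [abs_mul, abs_of_nonneg h0]
      exact mul_le_of_le_one_right (abs_nonneg x) h1
    exact (neg_le_abs _).trans this
  have b2 : t * (5 * ξ ^ 4 * y - 10 * ξ ^ 2 * y ^ 3 + y ^ 5) ≤ -4 * t := by
    have hy : y ^ 5 ≤ 1 := pow_le_one₀ h0 h1
    have : -4 ≤ 5 * ξ ^ 4 * y - 10 * ξ ^ 2 * y ^ 3 + y ^ 5 := by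
      nlinarith [mul_nonneg h0 (sq_nonneg (ξ ^ 2 - y ^ 2))]
    nlinarith
  gcongr

lemma aux_integrable (t x y : ℝ) (ht : t < 0) (h0 : 0 ≤ y) (h1 : y ≤ 1) :
    Integrable (fun ξ : ℝ => auxG t x ((ξ : ℂ) + y * Complex.I)) := by
  refine Integrable.mono' (integrable_inv_one_add_sq.const_mul
    (Real.exp |x| * Real.exp (-4 * t) * 4)) ?_
    (Filter.Eventually.of_forall fun ξ => aux_bound t x ξ y ht h0 h1)
  apply Continuous.aestronglyMeasurable
  unfold auxG
  refine Continuous.mul (by fun_prop) (Continuous.div (by fun_prop) (by fun_prop) ?_)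
  exact fun ξ => aux_den_ne ξ y h0 h1

open Filter Topology in
lemma aux_side (t x : ℝ) (ht : t < 0) (u : ℝ → ℝ) (hu : ∀ T, (u T) ^ 2 = T ^ 2) :
    Tendsto (fun T : ℝ => ∫ y in (0 : ℝ)..1, auxG t x ((u T : ℂ) + y * Complex.I))
      atTop (𝓝 0) := by
  have hlim : Tendsto (fun T : ℝ => (Real.exp |x| * Real.exp (-4 * t) * 4) * (1 + T ^ 2)⁻¹)
      atTop (𝓝 0) := by
    rw [← mul_zero (Real.exp |x| * Real.exp (-4 * t) * 4)]
    refine Tendsto.const_mul _ (tendsto_inv_atTop_zero.comp ?_)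
    exact tendsto_atTop_add_const_left _ _ (tendsto_pow_atTop two_ne_zero)
  refine squeeze_zero_norm (fun T => ?_) hlim
  have := intervalIntegral.norm_integral_le_of_norm_le_const
    (a := 0) (b := 1) (f := fun y : ℝ => auxG t x ((u T : ℂ) + y * Complex.I))
    (C := (Real.exp |x| * Real.exp (-4 * t) * 4) * (1 + T ^ 2)⁻¹) (fun y hy => by
      rw [Set.uIoc_of_le zero_le_one] at hy
      rw [← hu T]
      exact aux_bound t x (u T) y ht hy.1.le hy.2)
  simpa using this

open Filter Topology in
lemma aux_shift (t x : ℝ) (ht : t < 0) :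
    ∫ ξ : ℝ, auxG t x ((ξ : ℂ) + (0 : ℝ) * Complex.I)
      = ∫ ξ : ℝ, auxG t x ((ξ : ℂ) + (1 : ℝ) * Complex.I) := by
  have A0 := intervalIntegral_tendsto_integral
    (aux_integrable t x 0 ht le_rfl zero_le_one) tendsto_neg_atTop_atBot tendsto_id
  have A1 := intervalIntegral_tendsto_integral
    (aux_integrable t x 1 ht zero_le_one le_rfl) tendsto_neg_atTop_atBot tendsto_id
  have S1 := (aux_side t x ht (fun T => T) (fun T => rfl)).const_smul Complex.I
  have S2 := (aux_side t x ht (fun T => -T) (fun T => by ring)).const_smul Complex.I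
  have key := ((A0.sub A1).add S1).sub S2
  have z : ∀ T : ℝ, (∫ ξ in (-T)..(id T), auxG t x ((ξ : ℂ) + (0 : ℝ) * Complex.I))
      - (∫ ξ in (-T)..(id T), auxG t x ((ξ : ℂ) + (1 : ℝ) * Complex.I))
      + Complex.I • (∫ y in (0 : ℝ)..1, auxG t x ((T : ℂ) + y * Complex.I))
      - Complex.I • (∫ y in (0 : ℝ)..1, auxG t x (((-T : ℝ) : ℂ) + y * Complex.I)) = 0 := by
    intro T
    have := Complex.integral_boundary_rect_eq_zero_of_differentiableOn (auxG t x)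
      ⟨-T, 0⟩ ⟨T, 1⟩ (by
        intro w hw
        rw [Complex.mem_reProdIm] at hw
        have him := hw.2
        simp only [Set.uIcc_of_le (zero_le_one (α := ℝ))] at him
        have hne : w ^ 2 + 4 ≠ 0 := by
          have := aux_den_ne w.re w.im him.1 him.2
          rwa [Complex.re_add_im] at this
        apply DifferentiableAt.differentiableWithinAt
        unfold auxG
        refine DifferentiableAt.mul (by fun_prop) (DifferentiableAt.div (by fun_prop)
          (by fun_prop) hne))
    exact this
  have key' := key.congr z
  have := tendsto_nhds_unique key' tendsto_const_nhds
  simp only [smul_zero, add_zero, sub_zero] at this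
  exact sub_eq_zero.mp this

theorem stmt14 :
    ∀ t : ℝ, t < 0 → ∀ x : ℝ,
      Integrable (fun ξ : ℝ =>
        Complex.exp (Complex.I * x * ξ) * Complex.exp (-Complex.I * t * ξ ^ 5) * FT1 phi ξ) ∧
      Integrable (fun ξ : ℝ =>
        Complex.exp (Complex.I * x * ξ) *
          Complex.exp (-(t : ℂ) * (Complex.I * ξ - 1) ^ 5) * FT1 gfun ξ) ∧
      (Real.exp x : ℂ) * ((Real.sqrt (2 * π) : ℂ)⁻¹ *
          ∫ ξ : ℝ, Complex.exp (Complex.I * x * ξ) *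
            Complex.exp (-Complex.I * t * ξ ^ 5) * FT1 phi ξ) =
        (Real.sqrt (2 * π) : ℂ)⁻¹ *
          ∫ ξ : ℝ, Complex.exp (Complex.I * x * ξ) *
            Complex.exp (-(t : ℂ) * (Complex.I * ξ - 1) ^ 5) * FT1 gfun ξ := by
  intro t ht x
  have E0 : (fun ξ : ℝ => Complex.exp (Complex.I * x * ξ) * Complex.exp (-Complex.I * t * ξ ^ 5)
      * FT1 phi ξ) = fun ξ : ℝ => (Real.sqrt (2 * π) : ℂ)⁻¹
        * auxG t x ((ξ : ℂ) + (0 : ℝ) * Complex.I) := by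
    funext ξ
    rw [aux_FT_phi, auxG]
    simp only [Complex.ofReal_zero, zero_mul, add_zero]
    ring
  have E1 : (fun ξ : ℝ => Complex.exp (Complex.I * x * ξ) *
      Complex.exp (-(t : ℂ) * (Complex.I * ξ - 1) ^ 5) * FT1 gfun ξ) =
      fun ξ : ℝ => ((Real.exp x : ℂ) * (Real.sqrt (2 * π) : ℂ)⁻¹)
        * auxG t x ((ξ : ℂ) + (1 : ℝ) * Complex.I) := by
    funext ξ
    rw [aux_FT_g, auxG]
    have h1 : Complex.exp (Complex.I * x * ξ)
        = (Real.exp x : ℂ) * Complex.exp (Complex.I * x * ((ξ : ℂ) + (1 : ℝ) * Complex.I)) := by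
      rw [Complex.ofReal_exp, ← Complex.exp_add]
      congr 1
      push_cast
      linear_combination (-(x : ℂ)) * Complex.I_sq
    have h2 : -(t : ℂ) * (Complex.I * ξ - 1) ^ 5
        = -Complex.I * t * ((ξ : ℂ) + (1 : ℝ) * Complex.I) ^ 5 := by
      have : Complex.I * ξ - 1 = Complex.I * ((ξ : ℂ) + (1 : ℝ) * Complex.I) := by
        push_cast
        linear_combination (-1 : ℂ) * Complex.I_sq
      have i5 : Complex.I ^ 5 = Complex.I := by rw [pow_succ, Complex.I_pow_four]; ring
      rw [this, mul_pow, i5]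
      ring
    rw [h1, h2]
    ring
  rw [E0, E1]
  refine ⟨(aux_integrable t x 0 ht le_rfl zero_le_one).const_mul _,
    (aux_integrable t x 1 ht zero_le_one le_rfl).const_mul _, ?_⟩
  rw [integral_const_mul, integral_const_mul, aux_shift t x ht]
  ring
end

section
/- Let φ(x) = e^{-2|x|} and h(x) = e^{-x} e^{-2|x|}. For every t > 0 and every x ∈ ℝ, both integrals below converge absolutely and e^{-x} · (2π)^{-1/2} ∫_ℝ e^{ixξ} e^{-itξ⁵} φ̂(ξ) dξ = (2π)^{-1/2} ∫_ℝ e^{ixξ} e^{-t(iξ+1)⁵} ĥ(ξ) dξ. That is, the Fourier transform of x ↦ e^{-x} (W(t)φ)(x) equals ξ ↦ e^{-t(iξ+1)⁵} ĥ(ξ). -/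
open MeasureTheory
open scoped Real

/-- `h(x) = e^{-x} e^{-2|x|}`. -/
noncomputable def hfun (x : ℝ) : ℂ := ((Real.exp (-x) * Real.exp (-2 * |x|) : ℝ) : ℂ)

theorem integral_two_sided (w : ℂ) (h1 : -2 < w.re) (h2 : w.re < 2) :
    ∫ x : ℝ, Complex.exp (-w * x) * (Real.exp (-2 * |x|) : ℂ) = 4 / (4 - w ^ 2) := by
  have e1 : Set.EqOn (fun x : ℝ => Complex.exp (-w * x) * (Real.exp (-2 * |x|) : ℂ))
      (fun x : ℝ => Complex.exp ((2 - w) * x)) (Set.Iic 0) := by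
    intro x hx
    simp only [Set.mem_Iic] at hx
    simp only [abs_of_nonpos hx, Complex.ofReal_exp, ← Complex.exp_add]
    congr 1
    push_cast
    ring
  have e2 : Set.EqOn (fun x : ℝ => Complex.exp (-w * x) * (Real.exp (-2 * |x|) : ℂ))
      (fun x : ℝ => Complex.exp ((-2 - w) * x)) (Set.Ioi 0) := by
    intro x hx
    simp only [Set.mem_Ioi] at hx
    simp only [abs_of_pos hx, Complex.ofReal_exp, ← Complex.exp_add]
    congr 1
    push_cast
    ring
  have r1 : 0 < (2 - w).re := by simp; linarith
  have r2 : (-2 - w).re < 0 := by simp; linarith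
  have i1 := integrableOn_exp_mul_complex_Iic r1 0
  have i2 := integrableOn_exp_mul_complex_Ioi r2 0
  rw [← intervalIntegral.integral_Iic_add_Ioi (b := 0)
    (i1.congr_fun e1.symm measurableSet_Iic) (i2.congr_fun e2.symm measurableSet_Ioi),
    setIntegral_congr_fun measurableSet_Iic e1, setIntegral_congr_fun measurableSet_Ioi e2,
    integral_exp_mul_complex_Iic r1, integral_exp_mul_complex_Ioi r2]
  have n1 : 2 - w ≠ 0 := by intro h; rw [h] at r1; simp at r1
  have n2 : -2 - w ≠ 0 := by intro h; rw [h] at r2; simp at r2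
  have n3 : 4 - w ^ 2 ≠ 0 := by
    have : 4 - w ^ 2 = -((2 - w) * (-2 - w)) := by ring
    rw [this]
    exact neg_ne_zero.mpr (mul_ne_zero n1 n2)
  simp only [Complex.ofReal_zero, mul_zero, Complex.exp_zero]
  field_simp
  ring

/-- The holomorphic integrand. -/
noncomputable def GG (t x : ℝ) (z : ℂ) : ℂ :=
  Complex.exp (Complex.I * x * z) * Complex.exp (-Complex.I * t * z ^ 5) *
    ((Real.sqrt (2 * π) : ℂ)⁻¹ * (4 / (z ^ 2 + 4)))

theorem FT1_phi (ξ : ℝ) : FT1 phi ξ = (Real.sqrt (2 * π) : ℂ)⁻¹ * (4 / ((ξ : ℂ) ^ 2 + 4)) := by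
  have := integral_two_sided (Complex.I * ξ) (by simp) (by simp)
  unfold FT1 phi
  simp only [← neg_mul] at this
  rw [this]
  congr 2
  rw [mul_pow, Complex.I_sq]
  ring

theorem FT1_h (ξ : ℝ) : FT1 hfun ξ =
    (Real.sqrt (2 * π) : ℂ)⁻¹ * (4 / (((ξ : ℂ) - Complex.I) ^ 2 + 4)) := by
  have := integral_two_sided (Complex.I * ξ + 1) (by simp; norm_num) (by simp)
  have e : (4 : ℂ) - (Complex.I * ξ + 1) ^ 2 = ((ξ : ℂ) - Complex.I) ^ 2 + 4 := by
    linear_combination (-1 - (ξ : ℂ) ^ 2) * Complex.I_sq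
  rw [← e, ← this]
  unfold FT1 hfun
  congr 2
  ext x
  push_cast
  rw [← mul_assoc, ← Complex.exp_add]
  congr 2
  ring

theorem re_lower (a b : ℝ) (hb : b ∈ Set.Icc (-1 : ℝ) 0) :
    a ^ 2 + 3 ≤ ‖((a : ℂ) + b * Complex.I) ^ 2 + 4‖ := by
  refine le_trans ?_ (Complex.re_le_norm _)
  have : ((((a : ℂ) + b * Complex.I) ^ 2 + 4)).re = a ^ 2 - b ^ 2 + 4 := by
    simp [pow_two]
  rw [this]
  nlinarith [hb.1, hb.2]

theorem GG_bound (t x : ℝ) (ht : 0 < t) (a b : ℝ) (hb : b ∈ Set.Icc (-1 : ℝ) 0) :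
    ‖GG t x (a + b * Complex.I)‖ ≤
      (Real.exp |x| * Real.exp (4 * t) * (‖(Real.sqrt (2 * π) : ℂ)⁻¹‖ * 4)) * (1 + a ^ 2)⁻¹ := by
  obtain ⟨hb1, hb2⟩ := hb
  have hl := re_lower a b ⟨hb1, hb2⟩
  have k1 : ‖Complex.exp (Complex.I * x * (a + b * Complex.I))‖ ≤ Real.exp |x| := by
    rw [Complex.norm_exp]
    apply Real.exp_le_exp.mpr
    have : (Complex.I * x * (a + b * Complex.I)).re = -(x * b) := by simp
    rw [this]
    have h1 := neg_abs_le x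
    have h2 := le_abs_self x
    nlinarith
  have k2 : ‖Complex.exp (-Complex.I * t * (a + b * Complex.I) ^ 5)‖ ≤ Real.exp (4 * t) := by
    rw [Complex.norm_exp]
    apply Real.exp_le_exp.mpr
    have e : -Complex.I * t * (a + b * Complex.I) ^ 5 =
        ((t * (5 * b * (a ^ 2 - b ^ 2) ^ 2 - 4 * b ^ 5) : ℝ) : ℂ) +
        ((-t * (a ^ 5 - 10 * a ^ 3 * b ^ 2 + 5 * a * b ^ 4) : ℝ) : ℂ) * Complex.I := by
      have h2 := Complex.I_sq
      have h3 : Complex.I ^ 3 = -Complex.I := Complex.I_pow_three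
      have h4 : Complex.I ^ 4 = 1 := Complex.I_pow_four
      have h5 : Complex.I ^ 5 = Complex.I := by rw [pow_succ, h4, one_mul]
      have h6 : Complex.I ^ 6 = -1 := by rw [pow_succ, h5, Complex.I_mul_I]
      push_cast
      ring_nf
      simp only [h2, h3, h4, h5, h6]
      ring
    rw [e]
    simp only [Complex.add_re, Complex.ofReal_re, Complex.mul_re, Complex.I_re, Complex.I_im,
      Complex.ofReal_im, mul_zero, zero_mul, sub_zero, add_zero]
    have p : (-b) ^ 5 ≤ 1 := pow_le_one₀ (by linarith) (by linarith)
    have q : 5 * b * (a ^ 2 - b ^ 2) ^ 2 ≤ 0 :=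
      mul_nonpos_of_nonpos_of_nonneg (by linarith) (sq_nonneg _)
    have r : 5 * b * (a ^ 2 - b ^ 2) ^ 2 - 4 * b ^ 5 ≤ 4 := by
      have : (-b) ^ 5 = - b ^ 5 := by ring
      linarith
    nlinarith
  have k3 : ‖(4 : ℂ) / (((a : ℂ) + b * Complex.I) ^ 2 + 4)‖ ≤ 4 * (1 + a ^ 2)⁻¹ := by
    rw [norm_div, div_eq_mul_inv]
    have : ‖(4 : ℂ)‖ = 4 := by simp
    rw [this]
    have : 0 < 1 + a ^ 2 := by positivity
    gcongr
    linarith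
  unfold GG
  rw [norm_mul, norm_mul, norm_mul, mul_assoc (Real.exp |x| * Real.exp (4 * t)), mul_assoc _ 4]
  gcongr

theorem den_ne (a b : ℝ) (hb : b ∈ Set.Icc (-1 : ℝ) 0) :
    ((a : ℂ) + b * Complex.I) ^ 2 + 4 ≠ 0 := by
  have hl := re_lower a b hb
  intro h
  rw [h, norm_zero] at hl
  nlinarith [sq_nonneg a]

theorem GG_integrable (t x : ℝ) (ht : 0 < t) (b : ℝ) (hb : b ∈ Set.Icc (-1 : ℝ) 0) :
    Integrable (fun a : ℝ => GG t x (a + b * Complex.I)) := by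
  refine (integrable_inv_one_add_sq.const_mul _).mono' ?_
    (Filter.Eventually.of_forall fun a => GG_bound t x ht a b hb)
  apply Continuous.aestronglyMeasurable
  unfold GG
  have : Continuous fun a : ℝ => (4 : ℂ) / (((a : ℂ) + b * Complex.I) ^ 2 + 4) :=
    Continuous.div (by fun_prop) (by fun_prop) (fun a => den_ne a b hb)
  fun_prop

theorem GG_side (t x : ℝ) (ht : 0 < t) (s : ℝ) (hs : s ^ 2 = 1) :
    Filter.Tendsto (fun T : ℝ => ∫ y : ℝ in (-1)..0, GG t x ((s * T : ℝ) + y * Complex.I))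
      Filter.atTop (nhds 0) := by
  have hlim : Filter.Tendsto (fun T : ℝ =>
      (Real.exp |x| * Real.exp (4 * t) * (‖(Real.sqrt (2 * π) : ℂ)⁻¹‖ * 4)) * (1 + T ^ 2)⁻¹)
      Filter.atTop (nhds 0) := by
    have h := (Filter.tendsto_atTop_add_const_left Filter.atTop (1 : ℝ)
      (Filter.tendsto_pow_atTop (α := ℝ) (n := 2) (by norm_num))).inv_tendsto_atTop
    simpa using h.const_mul
      (Real.exp |x| * Real.exp (4 * t) * (‖(Real.sqrt (2 * π) : ℂ)⁻¹‖ * 4))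
  refine squeeze_zero_norm (fun T => ?_) hlim
  have := intervalIntegral.norm_integral_le_of_norm_le_const (a := -1) (b := 0)
    (f := fun y : ℝ => GG t x ((s * T : ℝ) + y * Complex.I))
    (C := (Real.exp |x| * Real.exp (4 * t) * (‖(Real.sqrt (2 * π) : ℂ)⁻¹‖ * 4)) * (1 + T ^ 2)⁻¹)
    (fun y hy => by
      rw [Set.uIoc_of_le (by norm_num)] at hy
      have := GG_bound t x ht (s * T) y ⟨hy.1.le, hy.2⟩
      rwa [mul_pow, hs, one_mul] at this)
  simpa using this

theorem GG_shift (t x : ℝ) (ht : 0 < t) :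
    ∫ a : ℝ, GG t x (a + ((-1 : ℝ) : ℂ) * Complex.I) =
      ∫ a : ℝ, GG t x (a + ((0 : ℝ) : ℂ) * Complex.I) := by
  have l1 := intervalIntegral_tendsto_integral
    (GG_integrable t x ht (-1) (by simp)) Filter.tendsto_neg_atTop_atBot Filter.tendsto_id
  have l2 := intervalIntegral_tendsto_integral
    (GG_integrable t x ht 0 (by simp)) Filter.tendsto_neg_atTop_atBot Filter.tendsto_id
  have l3 := (GG_side t x ht 1 (by norm_num)).const_smul Complex.I
  have l4 := (GG_side t x ht (-1) (by norm_num)).const_smul Complex.I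
  have l := ((l1.sub l2).add l3).sub l4
  have hz : ∀ T : ℝ, _ = (0 : ℂ) := fun T =>
    Complex.integral_boundary_rect_eq_zero_of_differentiableOn (GG t x) ⟨-T, -1⟩ ⟨T, 0⟩ (by
      intro z hz
      have hb : z.im ∈ Set.Icc (-1 : ℝ) 0 := by
        have := hz.2
        simpa [Set.uIcc_of_le] using this
      have hd : z ^ 2 + 4 ≠ 0 := by
        have := den_ne z.re z.im hb
        rwa [Complex.re_add_im] at this
      apply DifferentiableAt.differentiableWithinAt
      unfold GG
      have : DifferentiableAt ℂ (fun z : ℂ => (4 : ℂ) / (z ^ 2 + 4)) z :=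
        DifferentiableAt.div (by fun_prop) (by fun_prop) hd
      fun_prop)
  have l0 := l.congr (fun T => by simpa using hz T)
  have := tendsto_nhds_unique l0 tendsto_const_nhds
  simpa [sub_eq_zero] using this

theorem stmt15 :
    ∀ t : ℝ, 0 < t → ∀ x : ℝ,
      Integrable (fun ξ : ℝ =>
        Complex.exp (Complex.I * x * ξ) * Complex.exp (-Complex.I * t * ξ ^ 5) * FT1 phi ξ) ∧
      Integrable (fun ξ : ℝ =>
        Complex.exp (Complex.I * x * ξ) *
          Complex.exp (-(t : ℂ) * (Complex.I * ξ + 1) ^ 5) * FT1 hfun ξ) ∧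
      (Real.exp (-x) : ℂ) * ((Real.sqrt (2 * π) : ℂ)⁻¹ *
          ∫ ξ : ℝ, Complex.exp (Complex.I * x * ξ) *
            Complex.exp (-Complex.I * t * ξ ^ 5) * FT1 phi ξ) =
        (Real.sqrt (2 * π) : ℂ)⁻¹ *
          ∫ ξ : ℝ, Complex.exp (Complex.I * x * ξ) *
            Complex.exp (-(t : ℂ) * (Complex.I * ξ + 1) ^ 5) * FT1 hfun ξ := by
  intro t ht x
  have E1 : (fun ξ : ℝ => Complex.exp (Complex.I * x * ξ) *
      Complex.exp (-Complex.I * t * ξ ^ 5) * FT1 phi ξ) =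
      fun ξ : ℝ => GG t x (ξ + ((0 : ℝ) : ℂ) * Complex.I) := by
    ext ξ
    simp [FT1_phi, GG]
  have E2 : (fun ξ : ℝ => Complex.exp (Complex.I * x * ξ) *
      Complex.exp (-(t : ℂ) * (Complex.I * ξ + 1) ^ 5) * FT1 hfun ξ) =
      fun ξ : ℝ => (Real.exp (-x) : ℂ) * GG t x (ξ + ((-1 : ℝ) : ℂ) * Complex.I) := by
    ext ξ
    have ez : (ξ : ℂ) + ((-1 : ℝ) : ℂ) * Complex.I = ξ - Complex.I := by push_cast; ring
    have e1 : Complex.exp (Complex.I * x * ξ) =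
        (Real.exp (-x) : ℂ) * Complex.exp (Complex.I * x * (ξ - Complex.I)) := by
      rw [Complex.ofReal_exp, ← Complex.exp_add]
      congr 1
      push_cast
      linear_combination (x : ℂ) * Complex.I_sq
    have e2 : -(t : ℂ) * (Complex.I * ξ + 1) ^ 5 =
        -Complex.I * t * (ξ - Complex.I) ^ 5 := by
      have h : Complex.I * ξ + 1 = Complex.I * (ξ - Complex.I) := by
        linear_combination Complex.I_sq
      have h5 : Complex.I ^ 5 = Complex.I := by
        rw [pow_succ, Complex.I_pow_four, one_mul]
      rw [h, mul_pow, h5]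
      ring
    rw [ez, FT1_h, GG, e2, e1]
    ring
  rw [E1, E2]
  refine ⟨GG_integrable t x ht 0 (by simp), (GG_integrable t x ht (-1) (by simp)).const_mul _, ?_⟩
  rw [integral_const_mul, GG_shift t x ht]
  ring
end

section
/- For every natural number m ≥ 0 and every integer j ≥ 1, sup_{ξ ∈ ℝ} |ξ|^m e^{-5j(ξ²-1)²} ≤ ((1 + √(1 + m/(5j)))/2)^{m/2}. -/
theorem stmt16 (m : ℕ) (j : ℕ) (hj : 1 ≤ j) (ξ : ℝ) :
    |ξ| ^ m * Real.exp (-5 * j * (ξ ^ 2 - 1) ^ 2) ≤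
      ((1 + Real.sqrt (1 + (m : ℝ) / (5 * (j : ℝ)))) / 2) ^ ((m : ℝ) / 2) := by
  have hj0 : (0 : ℝ) < j := by exact_mod_cast hj
  have hs : Real.sqrt (1 + (m : ℝ) / (5 * (j : ℝ))) ^ 2 = 1 + (m : ℝ) / (5 * (j : ℝ)) :=
    Real.sq_sqrt (by positivity)
  have hs0 := Real.sqrt_nonneg (1 + (m : ℝ) / (5 * (j : ℝ)))
  generalize Real.sqrt (1 + (m : ℝ) / (5 * (j : ℝ))) = s at hs hs0 ⊢
  obtain ⟨R, hR⟩ : ∃ R, R = (1 + s) / 2 := ⟨_, rfl⟩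
  rw [← hR]
  have hR0 : 0 < R := by rw [hR]; positivity
  have hm : (m : ℝ) = 20 * j * (R * (R - 1)) := by
    have h1 : (m : ℝ) = (s ^ 2 - 1) * (5 * j) := by rw [hs]; field_simp; ring
    rw [h1, hR]; ring
  have hpow : |ξ| ^ m = (ξ ^ 2) ^ ((m : ℝ) / 2) := by
    rw [← sq_abs, ← Real.rpow_natCast |ξ| 2, ← Real.rpow_mul (abs_nonneg ξ),
      ← Real.rpow_natCast]
    congr 1; push_cast; ring
  have hy : ξ ^ 2 ≤ R * Real.exp (ξ ^ 2 / R - 1) := by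
    have h := Real.add_one_le_exp (ξ ^ 2 / R - 1)
    have h2 := mul_le_mul_of_nonneg_left h hR0.le
    have h3 : R * (ξ ^ 2 / R - 1 + 1) = ξ ^ 2 := by field_simp; ring
    linarith
  have h4 : (ξ ^ 2) ^ ((m : ℝ) / 2) ≤
      R ^ ((m : ℝ) / 2) * Real.exp ((ξ ^ 2 / R - 1) * ((m : ℝ) / 2)) := by
    rw [Real.exp_mul, ← Real.mul_rpow hR0.le (Real.exp_pos _).le]
    exact Real.rpow_le_rpow (sq_nonneg ξ) hy (by positivity)
  have h5 : (ξ ^ 2 / R - 1) * ((m : ℝ) / 2) = 10 * j * ((R - 1) * (ξ ^ 2 - R)) := by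
    rw [hm]; field_simp; ring
  rw [hpow]
  calc _ ≤ R ^ ((m : ℝ) / 2) * Real.exp ((ξ ^ 2 / R - 1) * ((m : ℝ) / 2)) *
        Real.exp (-5 * j * (ξ ^ 2 - 1) ^ 2) :=
        mul_le_mul_of_nonneg_right h4 (Real.exp_pos _).le
    _ ≤ R ^ ((m : ℝ) / 2) * 1 := by
        rw [mul_assoc, ← Real.exp_add]
        refine mul_le_mul_of_nonneg_left ?_ (by positivity)
        rw [Real.exp_le_one_iff, h5]
        have : 0 ≤ 5 * (j : ℝ) * ((ξ ^ 2 - R) ^ 2 + (R - 1) ^ 2) := by positivity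
        linarith
    _ = _ := mul_one _
end
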